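/- arXiv:1111.3388 — 3 statements merged into one kernel-verified Lean document; each statement's English description precedes it below -/
import Mathlib

section
/- Let s>0, t>0. Then for every point x ∈ B_{s,t} there exist a neighborhood U of x in B_{s,t} and a constant M>0 such that every harmonic map f: Δ → B_{s,t} with f(0) ∈ U satisfies ‖df(0)‖ < M. (By the tube-domain hyperbolicity criterion, this is equivalent to the Kobayashi hyperbolicity of the tube domain T_{B_{s,t}}.) -/
open Complex Metric Set Filter Topology

/-- The base domain `B_{s,t}`: `x₂ > x₁·log(t·x₁)` for `x₁ > 0`, `x₂ > 0` for `x₁ = 0`,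
and `x₂ > x₁·log(s·(-x₁))` for `x₁ < 0`. -/
def setB (s t : ℝ) : Set (ℝ × ℝ) :=
  {x | (0 < x.1 → x.1 * Real.log (t * x.1) < x.2) ∧ (x.1 = 0 → 0 < x.2) ∧
       (x.1 < 0 → x.1 * Real.log (s * (-x.1)) < x.2)}

/-- The Laplacian of `u : ℂ → ℝ`, as the sum of the second directional derivatives
in the directions `1` and `I`. -/
noncomputable def laplacian (u : ℂ → ℝ) (z : ℂ) : ℝ :=
  fderiv ℝ (fun w => fderiv ℝ u w 1) z 1 +
    fderiv ℝ (fun w => fderiv ℝ u w Complex.I) z Complex.I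

/-- A real-valued function is harmonic on a set if it is `C²` there and its
Laplacian vanishes there. -/
def HarmonicOn (u : ℂ → ℝ) (s : Set ℂ) : Prop :=
  ContDiffOn ℝ 2 u s ∧ ∀ z ∈ s, laplacian u z = 0

/-- A map `f = (u, v) : ℂ → ℝ²` is a harmonic map on a set if both components
are harmonic there. -/
def HarmonicMapOn (f : ℂ → ℝ × ℝ) (s : Set ℂ) : Prop :=
  HarmonicOn (fun z => (f z).1) s ∧ HarmonicOn (fun z => (f z).2) s

noncomputable def TT (a : ℕ → ℝ) (x : ℝ) : ℝ := ∑' p : ℕ, a p * Real.exp (2 * p * x)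

lemma TT_pos {a : ℕ → ℝ} (ha : ∀ p, 0 ≤ a p) (h1 : 1 ≤ a 0) {x : ℝ}
    (hs : Summable fun p : ℕ => a p * Real.exp (2 * p * x)) : 1 ≤ TT a x := by
  have : _ ≤ TT a x := Summable.le_tsum hs 0 (fun p _ => mul_nonneg (ha p) (Real.exp_pos _).le)
  simp at this
  exact h1.trans this

lemma TT_mono {a : ℕ → ℝ} (ha : ∀ p, 0 ≤ a p) {x y : ℝ} (hxy : x ≤ y)
    (hs : Summable fun p : ℕ => a p * Real.exp (2 * p * x))
    (hs' : Summable fun p : ℕ => a p * Real.exp (2 * p * y)) : TT a x ≤ TT a y := by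
  refine hs.tsum_le_tsum (fun p => ?_) hs'
  have := ha p
  gcongr

lemma TT_slope {a : ℕ → ℝ} (ha : ∀ p, 0 ≤ a p) {x h : ℝ} (hh : 0 ≤ h)
    (hs : Summable fun p : ℕ => a p * Real.exp (2 * p * x))
    (hs' : Summable fun p : ℕ => a p * Real.exp (2 * p * (x + h)))
    (h2 : 2 * a 0 ≤ TT a x) : Real.exp h * TT a x ≤ TT a (x + h) := by
  have e1 : TT a x = a 0 + ∑' p : ℕ, a (p+1) * Real.exp (2 * (p+1 : ℕ) * x) := by
    rw [TT, hs.tsum_eq_zero_add]; simp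
  have e2 : TT a (x+h) = a 0 + ∑' p : ℕ, a (p+1) * Real.exp (2 * (p+1 : ℕ) * (x+h)) := by
    rw [TT, hs'.tsum_eq_zero_add]; simp
  have t1 := (summable_nat_add_iff 1).2 hs
  have t2 := (summable_nat_add_iff 1).2 hs'
  have key : Real.exp (2*h) * ∑' p : ℕ, a (p+1) * Real.exp (2 * (p+1 : ℕ) * x) ≤
      ∑' p : ℕ, a (p+1) * Real.exp (2 * (p+1 : ℕ) * (x+h)) := by
    rw [← tsum_mul_left]
    refine (t1.mul_left _).tsum_le_tsum (fun p => ?_) t2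
    have e : Real.exp (2*h) * (a (p+1) * Real.exp (2 * (p+1 : ℕ) * x)) =
      a (p+1) * Real.exp (2*h + 2 * (p+1 : ℕ) * x) := by rw [Real.exp_add]; ring
    rw [e]
    have := ha (p+1)
    gcongr
    push_cast
    nlinarith [mul_nonneg (Nat.cast_nonneg (α := ℝ) p) hh]
  set R := ∑' p : ℕ, a (p+1) * Real.exp (2 * (p+1 : ℕ) * x)
  rw [e2]
  have e3 : Real.exp (2*h) = Real.exp h ^ 2 := by rw [← Real.exp_nat_mul]; norm_num
  rw [e3] at key
  have e4 : 1 ≤ Real.exp h := Real.one_le_exp hh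
  have : R ≥ a 0 := by linarith
  rw [e1]
  set E := Real.exp h
  nlinarith [mul_nonneg (mul_nonneg (by linarith : 0 ≤ E - 1) (by linarith : 0 ≤ R - a 0)) (by linarith : 0 ≤ E), mul_nonneg (sq_nonneg (E-1)) (ha 0)]

lemma card_window {h m : ℝ} (hh : 0 < h) (P : Finset ℕ) (hP : ∀ p ∈ P, |2 * h * p - m| < 3) :
    (P.card : ℝ) ≤ 3 / h + 1 := by
  rcases P.eq_empty_or_nonempty with rfl | hne
  · simp; positivity
  set q := P.min' hne
  have hq := hP q (P.min'_mem hne)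
  have hsub : P ⊆ Finset.Icc q (q + ⌊3 / h⌋₊) := by
    intro p hp
    have h1 := P.min'_le p hp
    have h2 := hP p hp
    rw [Finset.mem_Icc]
    refine ⟨h1, ?_⟩
    have : p - q ≤ ⌊3 / h⌋₊ := by
      apply Nat.le_floor
      rw [Nat.cast_sub h1, le_div_iff₀ hh]
      rw [abs_lt] at h2 hq
      linarith
    omega
  have := Finset.card_le_card hsub
  rw [Nat.card_Icc] at this
  have h3 : P.card ≤ ⌊3/h⌋₊ + 1 := by omega
  have h4 : (⌊3/h⌋₊ : ℝ) ≤ 3 / h := Nat.floor_le (by positivity)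
  have : (P.card : ℝ) ≤ (⌊3/h⌋₊ : ℝ) + 1 := by exact_mod_cast h3
  linarith

lemma mid_ineq {C : ℝ} (hC : 0 < C) {a : ℕ → ℝ} (ha : ∀ p, 0 ≤ a p) (h1 : 1 ≤ a 0) {x h : ℝ}
    (hh : 0 < h)
    (hs : Summable fun p : ℕ => a p * Real.exp (2 * p * x))
    (hs1 : Summable fun p : ℕ => a p * Real.exp (2 * p * (x - h)))
    (hs2 : Summable fun p : ℕ => a p * Real.exp (2 * p * (x + h)))
    (h2 : 2 * a 0 ≤ TT a x)
    (hstar : ∀ p : ℕ, 1 ≤ p → a p * (Real.log (TT a (x+h)) - Real.log (TT a (x-h)))^2 ≤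
      C * (TT a (x-h) * Real.exp (-(2 * p * (x-h))) + TT a (x+h) * Real.exp (-(2 * p * (x+h)))))
    (hL : 128 * C * (3 / h + 1) ≤ (Real.log (TT a (x+h)) - Real.log (TT a (x-h)))^2) :
    Real.log (TT a x) ≤
      (Real.log (TT a (x+h)) + Real.log (TT a (x-h))) / 2 - Real.log 2 := by
  have p0 := TT_pos ha h1 hs
  have p1 := TT_pos ha h1 hs1
  have p2 := TT_pos ha h1 hs2
  set f1 := Real.log (TT a (x-h)) with hf1
  set f2 := Real.log (TT a (x+h)) with hf2
  set L := (f2 - f1)^2 with hLdef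
  set G := Real.exp ((f2+f1)/2) with hG
  set m := (f2 - f1)/2 with hm
  have hGpos : 0 < G := Real.exp_pos _
  have hLpos : 0 < L := lt_of_lt_of_le (by positivity) hL
  have T1 : TT a (x-h) = G * Real.exp (-m) := by
    rw [hG, ← Real.exp_add, show (f2+f1)/2 + -m = f1 by rw [hm]; ring, hf1, Real.exp_log (by linarith)]
  have T2 : TT a (x+h) = G * Real.exp m := by
    rw [hG, ← Real.exp_add, show (f2+f1)/2 + m = f2 by rw [hm]; ring, hf2, Real.exp_log (by linarith)]
  let y : ℕ → ℝ := fun p => a p * Real.exp (2 * p * x)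
  let k : ℕ → ℝ := fun p => Real.exp (2 * h * p - m) + Real.exp (m - 2 * h * p)
  have hy : ∀ p, 0 ≤ y p := fun p => mul_nonneg (ha p) (Real.exp_pos _).le
  have hk : ∀ p, 0 < k p := fun p => by positivity
  have hyk : ∀ p, y p * k p = a p * Real.exp (2 * p * (x+h)) * Real.exp (-m) +
      a p * Real.exp (2 * p * (x-h)) * Real.exp m := by
    intro p
    simp only [y, k]
    rw [show 2 * (p:ℝ) * (x+h) = 2 * p * x + 2 * h * p by ring,
      show 2 * (p:ℝ) * (x-h) = 2 * p * x + -(2 * h * p) by ring, sub_eq_add_neg, sub_eq_add_neg,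
      Real.exp_add, Real.exp_add, Real.exp_add, Real.exp_add]
    ring
  have hsumk : HasSum (fun p => y p * k p) (2 * G) := by
    have := (hs2.hasSum.mul_right (Real.exp (-m))).add (hs1.hasSum.mul_right (Real.exp m))
    have e : TT a (x+h) * Real.exp (-m) + TT a (x-h) * Real.exp m = 2 * G := by
      rw [T1, T2]
      have : Real.exp m * Real.exp (-m) = 1 := by rw [← Real.exp_add]; simp
      linear_combination 2 * G * this
    rw [← e]
    simp only [hyk]
    exact this
  have hyb : ∀ p, 1 ≤ p → y p ≤ C * G * k p / L := by
    intro p hp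
    rw [le_div_iff₀ hLpos]
    have := hstar p hp
    have e : C * G * k p = Real.exp (2 * p * x) * (C * (TT a (x-h) * Real.exp (-(2 * p * (x-h))) + TT a (x+h) * Real.exp (-(2 * p * (x+h))))) := by
      rw [T1, T2]
      simp only [k]
      have e1 : Real.exp (2 * h * p - m) = Real.exp (2 * p * x) * (Real.exp (-m) * Real.exp (-(2 * p * (x-h)))) := by
        rw [← Real.exp_add, ← Real.exp_add]; ring_nf
      have e2 : Real.exp (m - 2 * h * p) = Real.exp (2 * p * x) * (Real.exp m * Real.exp (-(2 * p * (x+h)))) := by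
        rw [← Real.exp_add, ← Real.exp_add]; ring_nf
      rw [e1, e2]; ring
    rw [e]
    have := mul_le_mul_of_nonneg_left this (Real.exp_pos (2 * p * x)).le
    calc y p * L = Real.exp (2 * p * x) * (a p * L) := by simp only [y]; ring
      _ ≤ _ := this
  classical
  let P : Finset ℕ := (Finset.range (⌈(m+3)/(2*h)⌉₊ + 1)).filter (fun p => |2 * h * p - m| < 3)
  have hPc : (P.card : ℝ) ≤ 3 / h + 1 := card_window (m := m) hh P (fun p hp => by
    simp only [P, Finset.mem_filter] at hp; exact hp.2)
  have hPmem : ∀ p : ℕ, |2 * h * p - m| < 3 → p ∈ P := by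
    intro p hp
    simp only [P, Finset.mem_filter, Finset.mem_range]
    refine ⟨?_, hp⟩
    rw [Nat.lt_succ_iff]
    have : (p : ℝ) ≤ (m+3)/(2*h) := by
      rw [le_div_iff₀ (by positivity)]
      rw [abs_lt] at hp; linarith
    exact_mod_cast this.trans (Nat.le_ceil _)
  have hlarge : ∀ p : ℕ, p ∉ P → 16 ≤ k p := by
    intro p hp
    have hp' : 3 ≤ |2 * h * p - m| := by
      by_contra hcon; exact hp (hPmem p (not_le.1 hcon))
    have e16 : (16:ℝ) ≤ Real.exp 3 := by
      have := Real.exp_one_gt_d9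
      have e : Real.exp 3 = Real.exp 1 ^ 3 := by rw [← Real.exp_nat_mul]; norm_num
      rw [e]
      have : (2.7:ℝ) ≤ Real.exp 1 := by linarith
      calc (16:ℝ) ≤ 2.7^3 := by norm_num
        _ ≤ _ := by gcongr
    rcases le_abs'.1 hp' with h' | h'
    · have : Real.exp 3 ≤ Real.exp (m - 2 * h * p) := Real.exp_le_exp.2 (by linarith)
      have := Real.exp_pos (2 * h * p - m)
      simp only [k]; linarith
    · have : Real.exp 3 ≤ Real.exp (2 * h * p - m) := Real.exp_le_exp.2 (by linarith)
      have := Real.exp_pos (m - 2 * h * p)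
      simp only [k]; linarith
  have hterm : ∀ p, y p ≤ (if p ∈ ({0} : Finset ℕ) then a 0 else 0) + y p * k p * (1/16) +
      (if p ∈ P then 16 * C * G / L else 0) := by
    intro p
    have hn1 : (0:ℝ) ≤ (if p ∈ ({0} : Finset ℕ) then a 0 else 0) := by split_ifs <;> linarith
    have hn2 : (0:ℝ) ≤ (if p ∈ P then 16 * C * G / L else 0) := by split_ifs <;> positivity
    have hn3 := mul_nonneg (hy p) (hk p).le
    by_cases hk16 : 16 ≤ k p
    · nlinarith [mul_le_mul_of_nonneg_left hk16 (hy p)]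
    · rcases Nat.eq_zero_or_pos p with rfl | hp
      · have : y 0 = a 0 := by simp [y]
        simp only [Finset.mem_singleton, if_true]
        linarith
      · have hpP : p ∈ P := by
          by_contra hcon; exact hk16 (hlarge p hcon)
        have := hyb p hp
        rw [if_pos hpP]
        have : C * G * k p / L ≤ 16 * C * G / L := by
          rw [div_le_div_iff_of_pos_right hLpos]
          nlinarith [mul_pos hC hGpos]
        linarith
  have hI : ∀ (Q : Finset ℕ) (w : ℝ), HasSum (fun p => if p ∈ Q then w else 0) (Q.card * w) := by
    intro Q w
    have := hasSum_sum_of_ne_finset_zero (L := SummationFilter.unconditional ℕ) (f := fun p => if p ∈ Q then w else 0) (s := Q)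
      (fun p hp => if_neg hp)
    simpa using this
  have hsumR := ((hI {0} (a 0)).add (hsumk.mul_right (1/16))).add (hI P (16 * C * G / L))
  have hle : TT a x ≤ _ := hasSum_le hterm hs.hasSum hsumR
  simp only [Finset.card_singleton, Nat.cast_one, one_mul] at hle
  have hPG : P.card * (16 * C * G / L) ≤ G / 8 := by
    calc P.card * (16 * C * G / L) ≤ (3/h+1) * (16 * C * G / L) := by gcongr
      _ = (128 * C * (3/h+1)) * (G / (8 * L)) := by field_simp; ring
      _ ≤ L * (G / (8 * L)) := by gcongr
      _ = G / 8 := by field_simp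
  have hfin : TT a x ≤ G / 2 := by linarith
  have := Real.log_le_log (by linarith) hfin
  rw [Real.log_div hGpos.ne' (by norm_num), hG, Real.log_exp] at this
  exact this

lemma barrier_bounds {k d h : ℝ} (hk : 0 < k) (hd : 0 < d) (hh : 0 < h) (hhd : h ≤ d / 2)
    (h4 : 16 * k^2 * h^2 ≤ d^4) :
    k^2/(d-h)^2 + k^2/(d+h)^2 - 2 * (k^2/d^2) ≤ 7/9 := by
  have h1 : 0 < d - h := by linarith
  have h2 : 0 < d + h := by linarith
  have e : k^2/(d-h)^2 + k^2/(d+h)^2 - 2 * (k^2/d^2) =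
      k^2 * (6 * d^2*h^2 - 2*h^4) / (d^2 * ((d-h)*(d+h))^2) := by
    field_simp
    ring
  rw [e, div_le_iff₀ (by positivity)]
  have h3 : (3/4) * d^2 ≤ (d-h)*(d+h) := by nlinarith
  have h5 : ((3/4) * d^2)^2 ≤ ((d-h)*(d+h))^2 := by gcongr
  have h6 : d^2 * ((3/4) * d^2)^2 ≤ d^2 * ((d-h)*(d+h))^2 := by gcongr
  have h7 : k^2 * (6 * d^2*h^2) ≤ (6/16) * d^2 * d^4 := by nlinarith [mul_le_mul_of_nonneg_left h4 (sq_nonneg d)]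
  have h8 : 0 ≤ k^2 * h^4 := by positivity
  nlinarith [pow_pos hd 6]

lemma barrier_incr {k d h : ℝ} (hk : 0 < k) (hd : 0 < d) (hh : 0 < h) (hhd : h ≤ d / 2)
    (h4 : 4 * k * h = d^2) :
    (2/9) * (k / d) ≤ k^2/d^2 - k^2/(d+h)^2 := by
  have h2 : 0 < d + h := by linarith
  have e : k^2/d^2 - k^2/(d+h)^2 = (k^2 * (2*d*h + h^2)) / (d^2 * (d+h)^2) := by
    field_simp; ring
  have e2 : (2/9) * (k/d) = (2/9*k)/d := by ring
  rw [e, e2, div_le_div_iff₀ hd (by positivity)]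
  have h3 : (d+h)^2 ≤ (9/4) * d^2 := by nlinarith
  have h5 : 2/9*k*(d^2*(d+h)^2) ≤ 2/9*k*(d^2*((9/4) * d^2)) := by gcongr
  have h6 : 2/9*k*(d^2*((9/4) * d^2)) = k^2 * (2*d*h) * d := by
    linear_combination (-(k * d^2 / 2)) * h4
  have h7 : 0 ≤ k^2 * h^2 * d := by positivity
  nlinarith

lemma growth (C A0 : ℝ) (hC : 1 ≤ C) (hA : 1 ≤ A0) : ∃ N0 : ℝ, 1 ≤ N0 ∧ ∀ a : ℕ → ℝ, (∀ p, 0 ≤ a p) →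
    1 ≤ a 0 → a 0 ≤ A0 →
    (∀ x < 0, Summable fun p : ℕ => a p * Real.exp (2 * p * x)) →
    (∀ x y : ℝ, x < y → y < 0 → ∀ p : ℕ, 1 ≤ p →
      a p * (Real.log (TT a y) - Real.log (TT a x))^2 ≤
      C * (TT a x * Real.exp (-(2 * p * x)) + TT a y * Real.exp (-(2 * p * y)))) →
    TT a (-2) ≤ N0 := by
  set h1 : ℝ := 512 * C with hh1
  set k : ℝ := 81 * 128 * C * (12 + 4 * h1) with hk
  have h1pos : 1 ≤ h1 := by rw [hh1]; linarith
  have hk4 : 4 * h1 ≤ k := by rw [hk]; nlinarith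
  have hkpos : 0 < k := by linarith
  refine ⟨2 * A0 * Real.exp (k^2), ?_, ?_⟩
  · have : 1 ≤ Real.exp (k^2) := Real.one_le_exp (by positivity)
    nlinarith
  intro a ha ha1 haA hs hstar
  set f : ℝ → ℝ := fun x => Real.log (TT a x) with hf
  set b : ℝ → ℝ := fun x => k^2 / (-1 - x)^2 with hb
  have hT : ∀ x < 0, 1 ≤ TT a x := fun x hx => TT_pos ha ha1 (hs x hx)
  have fmono : ∀ x y, x ≤ y → y < 0 → f x ≤ f y := fun x y hxy hy =>
    Real.log_le_log (by linarith [hT x (by linarith)]) (TT_mono ha hxy (hs x (by linarith)) (hs y hy))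
  set F0 := Real.log (2 * a 0) with hF0
  have hbnn : ∀ x, 0 ≤ b x := fun x => by positivity
  suffices hmain : ∀ x < -1, f x - b x ≤ F0 by
    have := hmain (-2) (by norm_num)
    have hb2 : b (-2) = k^2 := by simp only [hb]; norm_num
    rw [hb2] at this
    have h' : Real.log (TT a (-2)) ≤ F0 + k^2 := by simp only [hf] at this; linarith
    rw [Real.log_le_iff_le_exp (by linarith [hT (-2) (by norm_num)]), Real.exp_add, hF0,
      Real.exp_log (by linarith)] at h'
    refine h'.trans ?_
    gcongr
  by_contra hcon
  push Not at hcon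
  obtain ⟨x0, hx0, hx0F⟩ := hcon
  set Sset : Set ℝ := (fun x => f x - b x) '' Set.Iio (-1) with hS
  have hbdd : BddAbove Sset := by
    refine ⟨f (-1), ?_⟩
    rintro _ ⟨x, hx, rfl⟩
    have := fmono x (-1) (le_of_lt hx) (by norm_num)
    have := hbnn x
    simp only; linarith
  have hne : Sset.Nonempty := ⟨_, x0, hx0, rfl⟩
  have hsupF : F0 < sSup Sset := lt_of_lt_of_le hx0F (le_csSup hbdd ⟨x0, hx0, rfl⟩)
  obtain ⟨_, ⟨x, hx, rfl⟩, hxs⟩ := exists_lt_of_lt_csSup hne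
    (show max F0 (sSup Sset - 1/9) < sSup Sset from max_lt hsupF (by linarith))
  have hxF : F0 < f x - b x := (le_max_left _ _).trans_lt hxs
  have hxsup : ∀ z < -1, f z - b z ≤ f x - b x + 1/9 := by
    intro z hz
    have := le_csSup hbdd (show f z - b z ∈ Sset from ⟨z, hz, rfl⟩)
    have h' : sSup Sset - 1/9 < f x - b x := (le_max_right _ _).trans_lt hxs
    linarith
  have hx' : x < -1 := hx
  set d := -1 - x with hd
  have hdpos : 0 < d := by linarith
  have hlarge : 2 * a 0 ≤ TT a x := by
    have : F0 ≤ f x := by linarith [hbnn x]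
    exact (Real.log_le_log_iff (by linarith) (by linarith [hT x (by linarith)])).1 this
  have hbx : b x = k^2/d^2 := rfl
  have hfinal : ∀ h, 0 < h → h ≤ d/2 → 16 * k^2*h^2 ≤ d^4 →
      128 * C * (3 / h + 1) ≤ (f (x+h) - f (x-h))^2 → False := by
    intro h hh hhd h4 hL
    have hm := mid_ineq (by linarith) ha ha1 hh (hs x (by linarith)) (hs (x-h) (by linarith))
      (hs (x+h) (by linarith)) hlarge (hstar (x-h) (x+h) (by linarith) (by linarith)) hL
    have b1 := hxsup (x+h) (by linarith)
    have b2 := hxsup (x-h) (by linarith)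
    have b3 := barrier_bounds hkpos hdpos hh hhd h4
    have e1 : b (x+h) = k^2/(d-h)^2 := by simp only [hb, hd]; ring_nf
    have e2 : b (x-h) = k^2/(d+h)^2 := by simp only [hb, hd]; ring_nf
    rw [e1, hbx] at b1
    rw [e2, hbx] at b2
    have := Real.log_two_gt_d9
    have hm' : f x ≤ (f (x+h) + f (x-h))/2 - Real.log 2 := hm
    linarith
  by_cases hcase : d^2 ≤ 4 * k * h1
  · have hdk : d ≤ k := by nlinarith
    set h := d^2 / (4*k) with hhdef
    have hh : 0 < h := by positivity
    have hkh : 4 * k * h = d^2 := by rw [hhdef]; field_simp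
    have hhd : h ≤ d/2 := by
      rw [hhdef, div_le_iff₀ (by positivity)]; nlinarith
    refine hfinal h hh hhd ?_ ?_
    · apply le_of_eq
      calc 16 * k^2*h^2 = (4*k*h)^2 := by ring
        _ = d^4 := by rw [hkh]; ring
    · have b2 := hxsup (x-h) (by linarith)
      have e2 : b (x-h) = k^2/(d+h)^2 := by simp only [hb, hd]; ring_nf
      have b4 := barrier_incr hkpos hdpos hh hhd hkh
      have b5 := fmono x (x+h) (by linarith) (by linarith)
      rw [e2, hbx] at b2
      have hkd : 1 ≤ k/d := by rw [le_div_iff₀ hdpos]; linarith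
      have b6 : (1/9) * (k/d) ≤ f (x+h) - f (x-h) := by linarith
      have b7 : ((1/9) * (k/d))^2 ≤ (f (x+h) - f (x-h))^2 := by gcongr
      refine le_trans ?_ b7
      have e3 : 128 * C * (3/h+1) = 128 * C * (12 * k + d^2)/d^2 := by
        rw [hhdef]; field_simp; try ring
      have e4 : ((1/9) * (k/d))^2 = (k^2/81)/d^2 := by field_simp; norm_num
      rw [e3, e4, div_le_div_iff_of_pos_right (by positivity)]
      have : 128 * C * (12 * k + d^2) ≤ 128 * C * (12 * k + 4 * k * h1) := by gcongr
      have e5 : k^2/81 = 128 * C * (12 * k + 4 * k * h1) := by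
        rw [sq]; nth_rewrite 1 [hk]; ring
      linarith
  · push Not at hcase
    have hhd : h1 ≤ d/2 := by nlinarith
    refine hfinal h1 (by linarith) hhd ?_ ?_
    · have : (4*k*h1)^2 ≤ (d^2)^2 := by gcongr
      nlinarith
    · have b1 := TT_slope ha (by linarith : 0 ≤ h1) (hs x (by linarith)) (hs (x+h1) (by linarith)) hlarge
      have b2 := Real.log_le_log (by have := hT x (by linarith); positivity) b1
      rw [Real.log_mul (Real.exp_pos _).ne' (by linarith [hT x (by linarith)]), Real.log_exp] at b2
      have b3 := fmono (x-h1) x (by linarith) (by linarith)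
      have b4 : h1 ≤ f (x+h1) - f (x-h1) := by simp only [hf] at b3 ⊢; linarith
      have b5 : h1^2 ≤ (f (x+h1) - f (x-h1))^2 := by gcongr
      refine le_trans ?_ b5
      have : 3/h1 ≤ 3 := by rw [div_le_iff₀ (by linarith)]; linarith
      nlinarith

lemma orth (m : ℤ) : ∫ θ in (0:ℝ)..(2 * Real.pi), Complex.exp (m * (θ * I)) =
    if m = 0 then ((2 * Real.pi : ℝ) : ℂ) else 0 := by
  split_ifs with h
  · subst h; simp
  · have hm : (m : ℂ) * I ≠ 0 := mul_ne_zero (by exact_mod_cast h) I_ne_zero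
    have e : ∀ θ : ℝ, Complex.exp (m * (θ * I)) = Complex.exp ((m * I) * θ) := fun θ => by ring_nf
    simp_rw [e]
    rw [integral_exp_mul_complex hm]
    have : Complex.exp ((m * I) * ((2 * Real.pi : ℝ) : ℂ)) = 1 := by
      rw [Complex.exp_eq_one_iff]
      exact ⟨m, by push_cast; ring⟩
    rw [this]; simp

/-- point on the circle -/
noncomputable def cp (ρ θ : ℝ) : ℂ := ρ * Complex.exp (θ * I)

lemma cp_norm {ρ : ℝ} (hρ : 0 ≤ ρ) (θ : ℝ) : ‖cp ρ θ‖ = ρ := by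
  rw [cp, norm_mul, Complex.norm_exp_ofReal_mul_I]; simp [abs_of_nonneg hρ]

lemma cp_mem {ρ : ℝ} (hρ : 0 ≤ ρ) (h1 : ρ < 1) (θ : ℝ) : cp ρ θ ∈ ball (0:ℂ) 1 := by
  rw [mem_ball_zero_iff, cp_norm hρ]; exact h1

lemma cp_cont (ρ : ℝ) : Continuous (cp ρ) := by unfold cp; fun_prop

lemma coef_summable {F : ℂ → ℂ} {c : ℕ → ℂ}
    (hF : ∀ z ∈ ball (0:ℂ) 1, HasSum (fun n => c n * z^n) (F z)) {ρ : ℝ} (hρ : 0 ≤ ρ) (h1 : ρ < 1) :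
    Summable fun n => ‖c n‖ * ρ^n := by
  have := (hF (ρ:ℂ) (by rw [mem_ball_zero_iff]; simpa [abs_of_nonneg hρ] using h1)).summable.norm
  simpa [abs_of_nonneg hρ] using this

lemma termwise {F : ℂ → ℂ} {c : ℕ → ℂ}
    (hF : ∀ z ∈ ball (0:ℂ) 1, HasSum (fun n => c n * z^n) (F z)) {ρ : ℝ} (hρ : 0 ≤ ρ) (h1 : ρ < 1)
    {g : ℝ → ℂ} (hg : Continuous g) {B : ℝ} (hB : ∀ θ, ‖g θ‖ ≤ B) :
    HasSum (fun n => ∫ θ in (0:ℝ)..(2 * Real.pi), c n * (cp ρ θ)^n * g θ)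
      (∫ θ in (0:ℝ)..(2 * Real.pi), F (cp ρ θ) * g θ) := by
  apply intervalIntegral.hasSum_integral_of_dominated_convergence
    (fun n _ => ‖c n‖ * ρ^n * B)
  · intro n
    have := cp_cont ρ
    exact (by fun_prop : Continuous fun θ => c n * (cp ρ θ)^n * g θ).aestronglyMeasurable
  · intro n
    refine Filter.Eventually.of_forall fun θ _ => ?_
    rw [norm_mul, norm_mul, norm_pow, cp_norm hρ]
    gcongr
    exact hB θ
  · refine Filter.Eventually.of_forall fun θ _ => ?_
    exact (coef_summable hF hρ h1).mul_right B
  · simp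
  · refine Filter.Eventually.of_forall fun θ _ => ?_
    exact (hF _ (cp_mem hρ h1 θ)).mul_right _

lemma fourier_coefc {F : ℂ → ℂ} {c : ℕ → ℂ}
    (hF : ∀ z ∈ ball (0:ℂ) 1, HasSum (fun n => c n * z^n) (F z)) {ρ : ℝ} (hρ : 0 ≤ ρ) (h1 : ρ < 1)
    (k : ℤ) :
    HasSum (fun n : ℕ => if (n : ℤ) = k then 2 * Real.pi * c n * ρ^n else 0)
    (∫ θ in (0:ℝ)..(2 * Real.pi), F (cp ρ θ) * Complex.exp (-(k * (θ * I)))) := by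
  have := termwise hF hρ h1 (g := fun θ => Complex.exp (-(k * (θ * I)))) (by fun_prop) (B := 1)
    (fun θ => by
      rw [show -((k:ℂ) * (θ * I)) = ((-(k * θ) : ℝ) : ℂ) * I by push_cast; ring,
        Complex.norm_exp_ofReal_mul_I])
  convert this using 2 with n
  have e : ∀ θ : ℝ, c n * (cp ρ θ)^n * Complex.exp (-(k * (θ * I))) =
      c n * ρ^n * Complex.exp (((n - k : ℤ) : ℂ) * (θ * I)) := by
    intro θ
    rw [cp, mul_pow, ← Complex.exp_nat_mul, mul_assoc, mul_assoc, ← Complex.exp_add, mul_assoc]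
    push_cast; ring_nf
  simp_rw [e]
  rw [intervalIntegral.integral_const_mul, orth]
  by_cases h : (n : ℤ) = k
  · rw [if_pos h, if_pos (by omega)]; push_cast; ring
  · rw [if_neg h, if_neg (by omega)]; simp

lemma fourier_posc {F : ℂ → ℂ} {c : ℕ → ℂ}
    (hF : ∀ z ∈ ball (0:ℂ) 1, HasSum (fun n => c n * z^n) (F z)) {ρ : ℝ} (hρ : 0 ≤ ρ) (h1 : ρ < 1)
    (p : ℕ) :
    ∫ θ in (0:ℝ)..(2 * Real.pi), F (cp ρ θ) * Complex.exp (-(p * (θ * I))) =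
      2 * Real.pi * c p * ρ^p := by
  have h := fourier_coefc hF hρ h1 (p : ℤ)
  have h' := hasSum_single (f := fun n : ℕ => if (n : ℤ) = (p:ℤ) then 2 * Real.pi * c n * (ρ:ℂ)^n else 0) p
    (fun n hn => if_neg (by exact_mod_cast hn))
  have := h.unique h'
  simpa using this

lemma fourier_negc {F : ℂ → ℂ} {c : ℕ → ℂ}
    (hF : ∀ z ∈ ball (0:ℂ) 1, HasSum (fun n => c n * z^n) (F z)) {ρ : ℝ} (hρ : 0 ≤ ρ) (h1 : ρ < 1)
    (p : ℕ) (hp : 1 ≤ p) :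
    ∫ θ in (0:ℝ)..(2 * Real.pi), F (cp ρ θ) * Complex.exp (p * (θ * I)) = 0 := by
  have h := fourier_coefc hF hρ h1 (-(p : ℤ))
  have e : (fun n : ℕ => if (n : ℤ) = -(p:ℤ) then 2 * Real.pi * c n * (ρ:ℂ)^n else 0) = fun _ => 0 := by
    funext n; exact if_neg (by omega)
  rw [e] at h
  have := h.unique hasSum_zero
  simpa using this

lemma circ_cont {F : ℂ → ℂ} (hc : ContinuousOn F (ball (0:ℂ) 1)) {ρ : ℝ} (hρ : 0 ≤ ρ) (h1 : ρ < 1) :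
    Continuous fun θ => F (cp ρ θ) :=
  hc.comp_continuous (cp_cont ρ) (fun θ => cp_mem hρ h1 θ)

lemma conj_int (g : ℝ → ℂ) : ∫ θ in (0:ℝ)..(2 * Real.pi), (starRingEnd ℂ) (g θ) =
    (starRingEnd ℂ) (∫ θ in (0:ℝ)..(2 * Real.pi), g θ) := by
  simp only [intervalIntegral, integral_conj, map_sub]

lemma fourier_re {F : ℂ → ℂ} {c : ℕ → ℂ} (hc : ContinuousOn F (ball (0:ℂ) 1))
    (hF : ∀ z ∈ ball (0:ℂ) 1, HasSum (fun n => c n * z^n) (F z)) {ρ : ℝ} (hρ : 0 ≤ ρ) (h1 : ρ < 1)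
    (p : ℕ) (hp : 1 ≤ p) :
    ∫ θ in (0:ℝ)..(2 * Real.pi), ((F (cp ρ θ)).re : ℂ) * Complex.exp (-(p * (θ * I))) =
      Real.pi * c p * ρ^p := by
  have hcc := circ_cont hc hρ h1
  have e : ∀ θ : ℝ, ((F (cp ρ θ)).re : ℂ) * Complex.exp (-(p * (θ * I))) =
      (1/2 : ℂ) * (F (cp ρ θ) * Complex.exp (-(p * (θ * I)))) +
      (1/2 : ℂ) * (starRingEnd ℂ) (F (cp ρ θ) * Complex.exp (p * (θ * I))) := by
    intro θ
    rw [Complex.re_eq_add_conj, map_mul, ← Complex.exp_conj]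
    simp only [map_mul, Complex.conj_I, Complex.conj_ofReal, map_natCast]
    rw [show (p:ℂ) * (θ * -I) = -(p * (θ * I)) by ring]
    ring
  simp_rw [e]
  rw [intervalIntegral.integral_add, intervalIntegral.integral_const_mul,
    intervalIntegral.integral_const_mul, conj_int, fourier_posc hF hρ h1, fourier_negc hF hρ h1 p hp]
  · simp; ring
  · exact (continuous_const.mul (hcc.mul (by fun_prop))).intervalIntegrable _ _
  · have : Continuous fun θ : ℝ => F (cp ρ θ) * Complex.exp (p * (θ * I)) :=
      hcc.mul (by fun_prop)
    exact (continuous_const.mul (Complex.continuous_conj.comp this)).intervalIntegrable _ _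

lemma mean_re {F : ℂ → ℂ} {c : ℕ → ℂ} (hc : ContinuousOn F (ball (0:ℂ) 1))
    (hF : ∀ z ∈ ball (0:ℂ) 1, HasSum (fun n => c n * z^n) (F z)) {ρ : ℝ} (hρ : 0 ≤ ρ) (h1 : ρ < 1) :
    ∫ θ in (0:ℝ)..(2 * Real.pi), (F (cp ρ θ)).re = 2 * Real.pi * (c 0).re := by
  have hcc := circ_cont hc hρ h1
  have h := fourier_posc hF hρ h1 0
  simp only [Nat.cast_zero, zero_mul, neg_zero, Complex.exp_zero, mul_one, pow_zero] at h
  have h2 := Complex.reCLM.intervalIntegral_comp_comm (hcc.intervalIntegrable (μ := MeasureTheory.volume) 0 (2 * Real.pi))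
  simp only [Complex.reCLM_apply] at h2
  rw [h2, h]
  simp

lemma parseval_circle {F : ℂ → ℂ} {c : ℕ → ℂ} (hc : ContinuousOn F (ball (0:ℂ) 1))
    (hF : ∀ z ∈ ball (0:ℂ) 1, HasSum (fun n => c n * z^n) (F z)) {ρ : ℝ} (hρ : 0 ≤ ρ) (h1 : ρ < 1) :
    HasSum (fun n => 2 * Real.pi * (‖c n‖^2 * ρ^(2*n)))
      (∫ θ in (0:ℝ)..(2 * Real.pi), ‖F (cp ρ θ)‖^2) := by
  have hcc := circ_cont hc hρ h1
  have hB : ∀ θ, ‖(starRingEnd ℂ) (F (cp ρ θ))‖ ≤ ∑' n, ‖c n‖ * ρ^n := by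
    intro θ
    rw [RCLike.norm_conj]
    have := (hF _ (cp_mem hρ h1 θ))
    rw [← this.tsum_eq]
    have e : ∀ n, ‖c n‖ * ρ^n = ‖c n * cp ρ θ ^ n‖ := fun n => by
      rw [norm_mul, norm_pow, cp_norm hρ]
    simp_rw [e]
    exact norm_tsum_le_tsum_norm this.summable.norm
  have h := termwise hF hρ h1 (g := fun θ => (starRingEnd ℂ) (F (cp ρ θ)))
    (Complex.continuous_conj.comp hcc) hB
  have e1 : ∀ n, ∫ θ in (0:ℝ)..(2 * Real.pi), c n * (cp ρ θ)^n * (starRingEnd ℂ) (F (cp ρ θ)) =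
      ((2 * Real.pi * (‖c n‖^2 * ρ^(2*n)) : ℝ) : ℂ) := by
    intro n
    have e : ∀ θ : ℝ, c n * (cp ρ θ)^n * (starRingEnd ℂ) (F (cp ρ θ)) =
        c n * ρ^n * (starRingEnd ℂ) (F (cp ρ θ) * Complex.exp (-(n * (θ * I)))) := by
      intro θ
      rw [map_mul, ← Complex.exp_conj]
      simp only [map_mul, map_neg, Complex.conj_I, Complex.conj_ofReal, map_natCast]
      rw [show -((n:ℂ) * (θ * -I)) = n * (θ * I) by ring, cp, mul_pow, ← Complex.exp_nat_mul]
      ring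
    simp_rw [e]
    rw [intervalIntegral.integral_const_mul, conj_int, fourier_posc hF hρ h1]
    simp only [map_mul, map_pow, Complex.conj_ofReal]
    have : c n * (starRingEnd ℂ) (c n) = ((‖c n‖^2 : ℝ) : ℂ) := by
      rw [Complex.mul_conj, Complex.normSq_eq_norm_sq]
    push_cast at this ⊢
    rw [show (starRingEnd ℂ) 2 = 2 from Complex.conj_ofNat 2]
    linear_combination (2 * Real.pi * (ρ:ℂ)^n * (ρ:ℂ)^n) * this
  have e2 : ∫ θ in (0:ℝ)..(2 * Real.pi), F (cp ρ θ) * (starRingEnd ℂ) (F (cp ρ θ)) =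
      ((∫ θ in (0:ℝ)..(2 * Real.pi), ‖F (cp ρ θ)‖^2 : ℝ) : ℂ) := by
    rw [← intervalIntegral.integral_ofReal]
    congr 1
    funext θ
    rw [Complex.mul_conj, Complex.normSq_eq_norm_sq]
  simp only [e1] at h
  rw [e2] at h
  exact_mod_cast h

noncomputable def phi (s t x : ℝ) : ℝ :=
  x * Real.log x + Real.log t * max x 0 + Real.log s * min x 0

lemma phi_cont (s t : ℝ) : Continuous (phi s t) := by
  unfold phi
  have := Real.continuous_mul_log
  fun_prop

lemma setB_eq {s t : ℝ} (hs : 0 < s) (ht : 0 < t) : setB s t = {x | phi s t x.1 < x.2} := by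
  ext ⟨x, y⟩
  simp only [setB, phi, Set.mem_ofPred_eq]
  rcases lt_trichotomy x 0 with h | h | h
  · have e : Real.log (s * -x) = Real.log s + Real.log x := by
      rw [Real.log_mul hs.ne' (by linarith), Real.log_neg_eq_log]
    rw [max_eq_right h.le, min_eq_left h.le, e]
    constructor
    · intro hh; have := hh.2.2 h; linarith
    · intro hh; exact ⟨fun h' => by linarith, fun h' => by linarith, fun _ => by linarith⟩
  · subst h; simp
  · have e : Real.log (t * x) = Real.log t + Real.log x := by
      rw [Real.log_mul ht.ne' (by linarith)]
    rw [max_eq_left h.le, min_eq_right h.le, e]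
    constructor
    · intro hh; have := hh.1 h; linarith
    · intro hh; exact ⟨fun _ => by linarith, fun h' => by linarith, fun h' => by linarith⟩

lemma ylog_bound (y : ℝ) : |y * Real.log y| ≤ 1 + y^2 := by
  rw [← Real.log_abs, abs_mul, ← sq_abs]
  set z := |y|
  have hz : 0 ≤ z := abs_nonneg y
  rcases hz.eq_or_lt with h | h
  · rw [← h]; simp
  have h1 := Real.log_le_sub_one_of_pos h
  have h2 := Real.log_le_sub_one_of_pos (inv_pos.2 h)
  rw [Real.log_inv] at h2
  have h3 : z * z⁻¹ = 1 := mul_inv_cancel₀ h.ne'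
  rcases abs_cases (Real.log z) with ⟨e, _⟩ | ⟨e, _⟩ <;> rw [e] <;> nlinarith

lemma phi_bound {s t Λ : ℝ} (hs : |Real.log s| ≤ Λ) (ht : |Real.log t| ≤ Λ) {N : ℝ} (hN : 1 ≤ N)
    (x : ℝ) : |phi s t x - Real.log N * x| ≤ (1 + Λ) * (N + x^2/N) := by
  have hN0 : 0 < N := by linarith
  have hΛ : 0 ≤ Λ := (abs_nonneg _).trans hs
  have h1 : |x * Real.log x - Real.log N * x| ≤ N + x^2/N := by
    rcases eq_or_ne x 0 with rfl | hx
    · simp; linarith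
    have e : x * Real.log x - Real.log N * x = N * ((x/N) * Real.log (x/N)) := by
      rw [Real.log_div hx hN0.ne']; field_simp
    rw [e, abs_mul, abs_of_pos hN0]
    calc N * |x/N * Real.log (x/N)| ≤ N * (1 + (x/N)^2) := by gcongr; exact ylog_bound _
      _ = N + x^2/N := by field_simp
  have h2 : |x| ≤ N + x^2/N := by
    have : |x| * N ≤ N * N + x^2 := by nlinarith [sq_nonneg (|x| - N), sq_abs x, abs_nonneg x]
    calc |x| = |x| * N / N := by field_simp
      _ ≤ (N * N + x^2)/N := by gcongr
      _ = _ := by field_simp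
  have h3 : |Real.log t * max x 0 + Real.log s * min x 0| ≤ Λ * |x| := by
    rcases le_total x 0 with h | h
    · rw [max_eq_right h, min_eq_left h, mul_zero, zero_add, abs_mul]; gcongr
    · rw [max_eq_left h, min_eq_right h, mul_zero, add_zero, abs_mul]; gcongr
  have e : phi s t x - Real.log N * x = (x * Real.log x - Real.log N * x) +
      (Real.log t * max x 0 + Real.log s * min x 0) := by unfold phi; ring
  rw [e]
  calc _ ≤ _ := abs_add_le _ _
    _ ≤ (N + x^2/N) + Λ * (N + x^2/N) := by gcongr; exact h3.trans (by gcongr)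
    _ = _ := by ring

lemma key_ineq {s t Λ : ℝ} (hs : |Real.log s| ≤ Λ) (ht : |Real.log t| ≤ Λ)
    {F G : ℂ → ℂ} {c d : ℕ → ℂ}
    (hFc : ContinuousOn F (ball (0:ℂ) 1)) (hGc : ContinuousOn G (ball (0:ℂ) 1))
    (hF : ∀ z ∈ ball (0:ℂ) 1, HasSum (fun n => c n * z^n) (F z))
    (hG : ∀ z ∈ ball (0:ℂ) 1, HasSum (fun n => d n * z^n) (G z))
    (hB : ∀ z ∈ ball (0:ℂ) 1, phi s t (F z).re < (G z).re)
    (hc0 : |(c 0).re| ≤ Λ) (hd0 : |(d 0).re| ≤ Λ)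
    {ρ : ℝ} (hρ : 0 ≤ ρ) (h1 : ρ < 1) {N : ℝ} (hN : 1 ≤ N)
    (hsum : ∑' n, ‖c n‖^2 * ρ^(2*n) ≤ N^2) (p : ℕ) (hp : 1 ≤ p) :
    ‖d p - Real.log N * c p‖ * ρ^p ≤ (8 + 12 * Λ) * N := by
  have hN0 : 0 < N := by linarith
  have hΛ : 0 ≤ Λ := (abs_nonneg _).trans hs
  have hFcc := circ_cont hFc hρ h1
  have hGcc := circ_cont hGc hρ h1
  have hpi := Real.pi_pos
  set u : ℝ → ℝ := fun θ => (F (cp ρ θ)).re with hu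
  set v : ℝ → ℝ := fun θ => (G (cp ρ θ)).re with hv
  have huc : Continuous u := Complex.continuous_re.comp hFcc
  have hvc : Continuous v := Complex.continuous_re.comp hGcc
  set ψ : ℝ → ℝ := fun θ => phi s t (u θ) - Real.log N * u θ with hψ
  have hψc : Continuous ψ := by
    have := (phi_cont s t).comp huc
    exact this.sub (continuous_const.mul huc)
  set E := ∫ θ in (0:ℝ)..(2 * Real.pi), |ψ θ| with hE
  have ii : ∀ g : ℝ → ℝ, Continuous g → IntervalIntegrable g MeasureTheory.volume 0 (2 * Real.pi) :=
    fun g hg => hg.intervalIntegrable _ _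
  -- L2 bound
  have hu2 : ∫ θ in (0:ℝ)..(2 * Real.pi), (u θ)^2 ≤ 2 * Real.pi * N^2 := by
    have hP := parseval_circle hFc hF hρ h1
    have : ∫ θ in (0:ℝ)..(2 * Real.pi), (u θ)^2 ≤ ∫ θ in (0:ℝ)..(2 * Real.pi), ‖F (cp ρ θ)‖^2 := by
      apply intervalIntegral.integral_mono_on (by positivity) (ii _ (huc.pow 2))
        (ii _ (hFcc.norm.pow 2))
      intro θ _
      show (u θ)^2 ≤ ‖F (cp ρ θ)‖^2
      rw [← sq_abs (u θ)]
      gcongr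
      exact Complex.abs_re_le_norm _
    rw [← hP.tsum_eq, tsum_mul_left] at this
    exact this.trans (by gcongr)
  have hEb : E ≤ (1 + Λ) * (4 * Real.pi * N) := by
    have : E ≤ ∫ θ in (0:ℝ)..(2 * Real.pi), (1+Λ) * (N + (u θ)^2/N) := by
      apply intervalIntegral.integral_mono_on (by positivity) (ii _ hψc.abs)
        (ii _ (by fun_prop))
      intro θ _
      exact phi_bound hs ht hN _
    rw [intervalIntegral.integral_const_mul, intervalIntegral.integral_add (ii _ continuous_const)
      (ii _ (by fun_prop)), intervalIntegral.integral_div, intervalIntegral.integral_const] at this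
    refine this.trans ?_
    gcongr
    have : (∫ θ in (0:ℝ)..(2 * Real.pi), (u θ)^2)/N ≤ 2 * Real.pi * N := by
      rw [div_le_iff₀ hN0]; linarith
    simp only [sub_zero, smul_eq_mul]
    linarith
  -- the positive function
  set w : ℝ → ℝ := fun θ => v θ - Real.log N * u θ - ψ θ with hw
  have hwc : Continuous w := (hvc.sub (continuous_const.mul huc)).sub hψc
  have hwpos : ∀ θ, 0 ≤ w θ := by
    intro θ
    have := hB _ (cp_mem hρ h1 θ)
    simp only [hw, hψ, hu, hv]; linarith
  have hwint : ∫ θ in (0:ℝ)..(2 * Real.pi), w θ ≤ 4 * Real.pi * Λ * N + E := by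
    have e1 : ∫ θ in (0:ℝ)..(2 * Real.pi), w θ = 2 * Real.pi * (d 0).re - Real.log N * (2 * Real.pi * (c 0).re)
        - ∫ θ in (0:ℝ)..(2 * Real.pi), ψ θ := by
      rw [← mean_re hFc hF hρ h1, ← mean_re hGc hG hρ h1, ← intervalIntegral.integral_const_mul,
        ← intervalIntegral.integral_sub, ← intervalIntegral.integral_sub]
      · exact ii _ (hvc.sub (continuous_const.mul huc))
      · exact ii _ hψc
      · exact ii _ hvc
      · exact ii _ (continuous_const.mul huc)
    have e2 : -E ≤ ∫ θ in (0:ℝ)..(2 * Real.pi), ψ θ := by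
      rw [hE, ← intervalIntegral.integral_neg]
      apply intervalIntegral.integral_mono_on (by positivity) (ii _ hψc.abs.neg) (ii _ hψc)
      intro θ _; exact neg_abs_le _
    have hl0 : 0 ≤ Real.log N := Real.log_nonneg hN
    have hl1 : Real.log N ≤ N := (Real.log_le_sub_one_of_pos hN0).trans (by linarith)
    have e3 : (d 0).re ≤ Λ * N := by
      have := (abs_le.1 hd0).2; nlinarith
    have e4 : -(Real.log N * (c 0).re) ≤ Λ * N := by
      have := (abs_le.1 hc0).1
      nlinarith [mul_le_mul_of_nonneg_left hl1 hΛ, mul_nonneg hl0 (by linarith : 0 ≤ Λ + (c 0).re)]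
    rw [e1]
    nlinarith
  set χ : ℝ → ℂ := fun θ => Complex.exp (-(p * (θ * I))) with hχ
  have hχc : Continuous χ := by simp only [hχ]; fun_prop
  have hχn : ∀ θ, ‖χ θ‖ = 1 := fun θ => by
    simp only [hχ]
    rw [show -((p:ℂ) * (θ * I)) = ((-(p * θ) : ℝ) : ℂ) * I by push_cast; ring,
        Complex.norm_exp_ofReal_mul_I]
  have hIntEq : Real.pi * (d p - Real.log N * c p) * ρ^p =
      ∫ θ in (0:ℝ)..(2 * Real.pi), ((w θ + ψ θ : ℝ) : ℂ) * χ θ := by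
    have a1 := fourier_re hGc hG hρ h1 p hp
    have a2 := fourier_re hFc hF hρ h1 p hp
    have e : ∀ θ, ((w θ + ψ θ : ℝ) : ℂ) * χ θ = ((G (cp ρ θ)).re : ℂ) * Complex.exp (-(p * (θ * I))) -
        Real.log N * (((F (cp ρ θ)).re : ℂ) * Complex.exp (-(p * (θ * I)))) := by
      intro θ
      simp only [hw, hχ, hu, hv]; push_cast; ring
    simp_rw [e]
    rw [intervalIntegral.integral_sub, intervalIntegral.integral_const_mul, a1, a2]
    · ring
    · exact ((Complex.continuous_ofReal.comp hvc).mul hχc).intervalIntegrable _ _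
    · exact (continuous_const.mul ((Complex.continuous_ofReal.comp huc).mul hχc)).intervalIntegrable _ _
  have hnorm : Real.pi * (‖d p - Real.log N * c p‖ * ρ^p) ≤ (∫ θ in (0:ℝ)..(2 * Real.pi), w θ) + E := by
    have e0 : Real.pi * (‖d p - Real.log N * c p‖ * ρ^p) = ‖Real.pi * (d p - Real.log N * c p) * (ρ:ℂ)^p‖ := by
      rw [norm_mul, norm_mul, norm_pow, Complex.norm_real, Complex.norm_real, Real.norm_of_nonneg hpi.le,
        Real.norm_of_nonneg hρ]; ring
    rw [e0, hIntEq, hE, ← intervalIntegral.integral_add (ii _ hwc) (ii _ hψc.abs)]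
    refine (intervalIntegral.norm_integral_le_integral_norm (by positivity)).trans ?_
    apply intervalIntegral.integral_mono_on (by positivity)
    · exact ii _ ((Complex.continuous_ofReal.comp (hwc.add hψc)).mul hχc).norm
    · exact ii _ (hwc.add hψc.abs)
    · intro θ _
      rw [norm_mul, hχn, mul_one, Complex.norm_real, Real.norm_eq_abs]
      exact (abs_add_le _ _).trans (by rw [abs_of_nonneg (hwpos θ)])
  have hfin : Real.pi * (‖d p - Real.log N * c p‖ * ρ^p) ≤ Real.pi * ((8 + 12 * Λ) * N) := by
    linarith
  exact le_of_mul_le_mul_left hfin hpi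

lemma star_ineq {s t Λ : ℝ} (hs : |Real.log s| ≤ Λ) (ht : |Real.log t| ≤ Λ)
    {F G : ℂ → ℂ} {c d : ℕ → ℂ}
    (hFc : ContinuousOn F (ball (0:ℂ) 1)) (hGc : ContinuousOn G (ball (0:ℂ) 1))
    (hF : ∀ z ∈ ball (0:ℂ) 1, HasSum (fun n => c n * z^n) (F z))
    (hG : ∀ z ∈ ball (0:ℂ) 1, HasSum (fun n => d n * z^n) (G z))
    (hB : ∀ z ∈ ball (0:ℂ) 1, phi s t (F z).re < (G z).re)
    (hc0 : ‖c 0‖ ≤ Λ) (hd0 : |(d 0).re| ≤ Λ) {N0 : ℝ} (hN01 : 1 ≤ N0)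
    (hN0 : ∀ a : ℕ → ℝ, (∀ p, 0 ≤ a p) →
      1 ≤ a 0 → a 0 ≤ Λ^2 + 1 →
      (∀ x < 0, Summable fun p : ℕ => a p * Real.exp (2 * p * x)) →
      (∀ x y : ℝ, x < y → y < 0 → ∀ p : ℕ, 1 ≤ p →
      a p * (Real.log (TT a y) - Real.log (TT a x))^2 ≤
      (8 * (8 + 12 * Λ)^2) * (TT a x * Real.exp (-(2 * p * x)) + TT a y * Real.exp (-(2 * p * y)))) →
      TT a (-2) ≤ N0) :
    ‖c 1‖ ≤ Real.sqrt N0 * Real.exp 2 ∧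
    ‖d 1‖ ≤ Real.log (Real.sqrt N0) * (Real.sqrt N0 * Real.exp 2) +
      (8 + 12 * Λ) * Real.sqrt N0 * Real.exp 2 := by
  have hΛ : 0 ≤ Λ := (abs_nonneg _).trans hs
  have hc0' : |(c 0).re| ≤ Λ := (Complex.abs_re_le_norm _).trans hc0
  set a : ℕ → ℝ := fun p => if p = 0 then Λ^2 + 1 else ‖c p‖^2 with ha
  have ha0 : ∀ p, 0 ≤ a p := by intro p; simp only [ha]; split_ifs <;> positivity
  have ha1 : 1 ≤ a 0 := by simp only [ha, if_true]; nlinarith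
  have hca : ∀ p, ‖c p‖^2 ≤ a p := by
    intro p
    simp only [ha]
    split_ifs with h
    · subst h; nlinarith [norm_nonneg (c 0)]
    · exact le_rfl
  have hap : ∀ p, 1 ≤ p → a p = ‖c p‖^2 := fun p hp => by
    simp only [ha]; rw [if_neg (by omega)]
  have hexp : ∀ (x : ℝ) (p : ℕ), Real.exp x ^ (2*p) = Real.exp (2 * p * x) := by
    intro x p; rw [← Real.exp_nat_mul]; push_cast; ring_nf
  have hsumc : ∀ x < 0, Summable fun p : ℕ => ‖c p‖^2 * Real.exp (2 * p * x) := by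
    intro x hx
    have := (parseval_circle hFc hF (Real.exp_pos x).le (by rwa [Real.exp_lt_one_iff])).summable
    simp only [hexp] at this
    exact (summable_mul_left_iff (by positivity)).1 this
  have hsuma : ∀ x < 0, Summable fun p : ℕ => a p * Real.exp (2 * p * x) := by
    intro x hx
    rw [← summable_nat_add_iff 1]
    have := (summable_nat_add_iff 1).2 (hsumc x hx)
    simpa only [hap _ (Nat.le_add_left 1 _)] using this
  have hle : ∀ x < 0, ∑' n, ‖c n‖^2 * Real.exp x ^(2*n) ≤ TT a x := by
    intro x hx
    simp only [hexp]
    exact (hsumc x hx).tsum_le_tsum (fun p => by have := hca p; gcongr) (hsuma x hx)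
  have hkey : ∀ x < 0, ∀ N, 1 ≤ N → TT a x ≤ N^2 → ∀ p, 1 ≤ p →
      ‖d p - Real.log N * c p‖ ≤ (8 + 12 * Λ) * N * Real.exp (-(p * x)) := by
    intro x hx N hN hT p hp
    have h := key_ineq hs ht hFc hGc hF hG hB hc0' hd0 (Real.exp_pos x).le
      (by rwa [Real.exp_lt_one_iff]) hN ((hle x hx).trans hT) p hp
    rw [← Real.exp_nat_mul] at h
    calc _ = ‖d p - Real.log N * c p‖ * Real.exp (p * x) * Real.exp (-(p*x)) := by
          rw [mul_assoc, ← Real.exp_add]; simp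
      _ ≤ _ := by gcongr
  have hT1 : ∀ x < 0, 1 ≤ TT a x := fun x hx => TT_pos ha0 ha1 (hsuma x hx)
  have hmain : TT a (-2) ≤ N0 := by
    refine hN0 a ha0 ha1 (by simp [ha]) hsuma ?_
    intro x y hxy hy p hp
    have hx : x < 0 := hxy.trans hy
    have tx := hT1 x hx
    have ty := hT1 y hy
    have k1 := hkey x hx (Real.sqrt (TT a x)) (Real.one_le_sqrt.2 tx) (Real.sq_sqrt (by linarith)).ge p hp
    have k2 := hkey y hy (Real.sqrt (TT a y)) (Real.one_le_sqrt.2 ty) (Real.sq_sqrt (by linarith)).ge p hp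
    rw [Real.log_sqrt (by linarith)] at k1 k2
    rw [hap p hp]
    set K := 8 + 12 * Λ
    set lx := Real.log (TT a x)
    set ly := Real.log (TT a y)
    have e : ((ly - lx)/2 : ℝ) * c p = (d p - (lx/2 : ℝ) * c p) - (d p - (ly/2 : ℝ) * c p) := by
      push_cast; ring
    have n1 : ‖(((ly - lx)/2 : ℝ) : ℂ) * c p‖ ≤ K * Real.sqrt (TT a x) * Real.exp (-(p*x)) +
        K * Real.sqrt (TT a y) * Real.exp (-(p*y)) := by
      rw [e]; exact (norm_sub_le _ _).trans (add_le_add k1 k2)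
    have n2 := pow_le_pow_left₀ (norm_nonneg _) n1 2
    rw [norm_mul, mul_pow, Complex.norm_real, Real.norm_eq_abs, sq_abs] at n2
    have ex : ∀ z : ℝ, Real.exp (-(2 * p * z)) = Real.exp (-(p*z))^2 := by
      intro z; rw [← Real.exp_nat_mul]; push_cast; ring_nf
    rw [ex, ex]
    set A := Real.exp (-(p*x))
    set B := Real.exp (-(p*y))
    have sx := Real.sq_sqrt (by linarith : 0 ≤ TT a x)
    have sy := Real.sq_sqrt (by linarith : 0 ≤ TT a y)
    set X := Real.sqrt (TT a x)
    set Y := Real.sqrt (TT a y)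
    rw [← sx, ← sy]
    nlinarith [sq_nonneg (K * X * A - K * Y * B)]
  have h2 : (-2:ℝ) < 0 := by norm_num
  set R := Real.sqrt N0 with hR
  have hR1 : 1 ≤ R := Real.one_le_sqrt.2 hN01
  have hR2 : R^2 = N0 := Real.sq_sqrt (by linarith)
  have hc1 : ‖c 1‖ ≤ R * Real.exp 2 := by
    have h := (hsuma (-2) h2).le_tsum 1 (fun p _ => mul_nonneg (ha0 p) (Real.exp_pos _).le)
    rw [hap 1 le_rfl] at h
    have h' : ‖c 1‖^2 * Real.exp (2 * (1:ℕ) * (-2)) ≤ R^2 := by rw [hR2]; exact h.trans hmain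
    have e : Real.exp (2 * (1:ℕ) * (-2)) = Real.exp (-2)^2 := by
      rw [← Real.exp_nat_mul]; norm_num
    rw [e, ← mul_pow] at h'
    have h3 := abs_le_of_sq_le_sq h' (by linarith)
    have h4 := (abs_le.1 (abs_le_of_sq_le_sq h' (by linarith) |> fun q => (by simpa using q : |‖c 1‖ * Real.exp (-2)| ≤ R))).2
    calc ‖c 1‖ = ‖c 1‖ * Real.exp (-2) * Real.exp 2 := by rw [mul_assoc, ← Real.exp_add]; simp
      _ ≤ _ := by gcongr
  refine ⟨hc1, ?_⟩
  have k := hkey (-2) h2 R hR1 (by rw [hR2]; exact hmain) 1 le_rfl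
  have hl : 0 ≤ Real.log R := Real.log_nonneg hR1
  have e : d 1 = Real.log R * c 1 + (d 1 - Real.log R * c 1) := by ring
  rw [e]
  refine (norm_add_le _ _).trans ?_
  have e2 : Real.exp (-((1:ℕ) * (-2))) = Real.exp 2 := by norm_num
  rw [e2] at k
  refine add_le_add ?_ k
  rw [norm_mul, Complex.norm_real, Real.norm_of_nonneg hl]
  gcongr

lemma harm_bridge {u : ℂ → ℝ} (h : HarmonicOn u (ball (0:ℂ) 1)) :
    ∃ F : ℂ → ℂ, DifferentiableOn ℂ F (ball (0:ℂ) 1) ∧ (∀ z ∈ ball (0:ℂ) 1, (F z).re = u z) ∧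
      F 0 = u 0 := by
  have hopen : IsOpen (ball (0:ℂ) 1) := isOpen_ball
  have hH : InnerProductSpace.HarmonicOnNhd u (ball (0:ℂ) 1) := by
    have hl : ∀ z ∈ ball (0:ℂ) 1, Laplacian.laplacian u z = 0 := by
      intro z hz
      have hcd : ContDiffAt ℝ 2 u z := h.1.contDiffAt (hopen.mem_nhds hz)
      have hd : DifferentiableAt ℝ (fderiv ℝ u) z :=
        (hcd.fderiv_right (m := 1) (by norm_num)).differentiableAt (by norm_num)
      have := h.2 z hz
      rw [InnerProductSpace.laplacian_eq_iteratedFDeriv_complexPlane]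
      simp only [iteratedFDeriv_two_apply]
      unfold laplacian at this
      rw [fderiv_clm_apply hd (by fun_prop), fderiv_clm_apply hd (by fun_prop)] at this
      simpa using this
    intro z hz
    refine ⟨h.1.contDiffAt (hopen.mem_nhds hz), ?_⟩
    filter_upwards [hopen.mem_nhds hz] with w hw
    exact hl w hw
  obtain ⟨F, hF, hre⟩ := hH.exists_analyticOnNhd_ball_re_eq
  have h0 : (0:ℂ) ∈ ball (0:ℂ) 1 := mem_ball_self one_pos
  refine ⟨fun z => F z - ((F 0).im : ℂ) * I, hF.differentiableOn.sub_const _, ?_, ?_⟩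
  · intro z hz
    simpa using hre hz
  · have := hre h0
    simp only at this
    apply Complex.ext
    · simpa using this
    · simp

lemma taylor_coef {F : ℂ → ℂ} (hF : DifferentiableOn ℂ F (ball (0:ℂ) 1)) :
    ∃ c : ℕ → ℂ, (∀ z ∈ ball (0:ℂ) 1, HasSum (fun n => c n * z^n) (F z)) ∧ c 0 = F 0 ∧
      c 1 = deriv F 0 := by
  refine ⟨fun n => (n.factorial : ℂ)⁻¹ * iteratedDeriv n F 0, ?_, ?_, ?_⟩
  · intro z hz
    have := Complex.hasSum_taylorSeries_on_ball hF hz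
    simp only [sub_zero, smul_eq_mul] at this
    have e : (fun n : ℕ => (n.factorial : ℂ)⁻¹ * iteratedDeriv n F 0 * z^n) =
        fun n : ℕ => (n.factorial : ℂ)⁻¹ * (z^n * iteratedDeriv n F 0) := by
      funext n; ring
    show HasSum (fun n : ℕ => (n.factorial : ℂ)⁻¹ * iteratedDeriv n F 0 * z^n) _
    rw [e]
    exact this
  · simp
  · simp [iteratedDeriv_one]

lemma fderiv_re {F : ℂ → ℂ} {u : ℂ → ℝ} (hF : DifferentiableOn ℂ F (ball (0:ℂ) 1))
    (hre : ∀ z ∈ ball (0:ℂ) 1, (F z).re = u z) :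
    DifferentiableAt ℝ u 0 ∧ ‖fderiv ℝ u 0‖ ≤ ‖deriv F 0‖ := by
  have hn : ball (0:ℂ) 1 ∈ 𝓝 (0:ℂ) := ball_mem_nhds _ one_pos
  have hd : HasDerivAt F (deriv F 0) 0 := (hF.differentiableAt hn).hasDerivAt
  have h1 : HasFDerivAt (fun z => (F z).re)
      (Complex.reCLM.comp ((ContinuousLinearMap.toSpanSingleton ℂ (deriv F 0)).restrictScalars ℝ)) 0 :=
    Complex.reCLM.hasFDerivAt.comp 0 (hd.hasFDerivAt.restrictScalars ℝ)
  have h2 := h1.congr_of_eventuallyEq (f₁ := u) (by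
    filter_upwards [hn] with z hz; exact (hre z hz).symm)
  refine ⟨h2.differentiableAt, ?_⟩
  rw [h2.fderiv]
  refine ContinuousLinearMap.opNorm_le_bound _ (norm_nonneg _) fun z => ?_
  simp only [ContinuousLinearMap.comp_apply, Complex.reCLM_apply]
  refine (Complex.abs_re_le_norm _).trans ?_
  simp [mul_comm]

/-- Harmonic-map hyperbolicity criterion for `B_{s,t}`: every point of the base has
a neighborhood on which derivatives at `0` of harmonic maps from the unit disk into
the base are uniformly bounded. -/
theorem baseB_harmonic_hyperbolic (s t : ℝ) (hs : 0 < s) (ht : 0 < t)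
    (x : ℝ × ℝ) (hx : x ∈ setB s t) :
    ∃ U ⊆ setB s t, U ∈ 𝓝 x ∧ ∃ M > (0 : ℝ),
      ∀ f : ℂ → ℝ × ℝ, HarmonicMapOn f (ball (0 : ℂ) 1) →
        MapsTo f (ball (0 : ℂ) 1) (setB s t) → f 0 ∈ U →
          ‖fderiv ℝ f 0‖ < M := by
  have hBe := setB_eq hs ht
  have hopen : IsOpen (setB s t) := by
    rw [hBe]
    exact isOpen_lt ((phi_cont s t).comp continuous_fst) continuous_snd
  set Λ : ℝ := |Real.log s| + |Real.log t| + ‖x‖ + 1 with hΛdef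
  have p1 := abs_nonneg (Real.log s)
  have p2 := abs_nonneg (Real.log t)
  have p3 := norm_nonneg x
  have hΛ : 1 ≤ Λ := by linarith
  obtain ⟨N0, hN01, hN0⟩ := growth (8 * (8 + 12 * Λ)^2) (Λ^2+1) (by nlinarith) (by nlinarith)
  set R := Real.sqrt N0
  set M1 := R * Real.exp 2
  set M2 := Real.log R * (R * Real.exp 2) + (8 + 12 * Λ) * R * Real.exp 2
  refine ⟨setB s t ∩ ball x 1, inter_subset_left,
    inter_mem (hopen.mem_nhds hx) (ball_mem_nhds x one_pos), |M1| + |M2| + 1, by positivity, ?_⟩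
  intro f hf hmaps hf0
  obtain ⟨F, hFd, hFre, hF0⟩ := harm_bridge hf.1
  obtain ⟨G, hGd, hGre, hG0⟩ := harm_bridge hf.2
  obtain ⟨c, hc, hcz, hc1⟩ := taylor_coef hFd
  obtain ⟨d, hd, hdz, hd1⟩ := taylor_coef hGd
  have hnf : ‖f 0‖ ≤ Λ := by
    have h1 : ‖f 0 - x‖ < 1 := by rw [← dist_eq_norm]; exact hf0.2
    have h2 : ‖f 0‖ ≤ ‖f 0 - x‖ + ‖x‖ := by
      have := norm_add_le (f 0 - x) x; simpa using this
    linarith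
  have hB : ∀ z ∈ ball (0:ℂ) 1, phi s t (F z).re < (G z).re := by
    intro z hz
    have := hmaps hz
    rw [hBe] at this
    rw [hFre z hz, hGre z hz]
    exact this
  have hc0 : ‖c 0‖ ≤ Λ := by
    rw [hcz, hF0, Complex.norm_real]
    exact (norm_fst_le (f 0)).trans hnf
  have hd0 : |(d 0).re| ≤ Λ := by
    rw [hdz, hG0, Complex.ofReal_re, ← Real.norm_eq_abs]
    exact (norm_snd_le (f 0)).trans hnf
  obtain ⟨b1, b2⟩ := star_ineq (by linarith) (by linarith) hFd.continuousOn hGd.continuousOn hc hd hB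
    hc0 hd0 hN01 hN0
  obtain ⟨du, bu⟩ := fderiv_re hFd hFre
  obtain ⟨dv, bv⟩ := fderiv_re hGd hGre
  have e : fderiv ℝ f 0 = (fderiv ℝ (fun z => (f z).1) 0).prod (fderiv ℝ (fun z => (f z).2) 0) :=
    (du.hasFDerivAt.prodMk dv.hasFDerivAt).fderiv
  rw [e]
  have hle : ‖(fderiv ℝ (fun z => (f z).1) 0).prod (fderiv ℝ (fun z => (f z).2) 0)‖ ≤ |M1| + |M2| := by
    rw [ContinuousLinearMap.opNorm_prod, Prod.norm_def]
    have q1 := le_abs_self M1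
    have q2 := le_abs_self M2
    have q3 := abs_nonneg M1
    have q4 := abs_nonneg M2
    rw [hc1] at b1
    rw [hd1] at b2
    exact max_le (by linarith) (by linarith)
  linarith
end

section
/- Let α>0, t>0 and e^{−2πα}·t < s < t. Then for every point x ∈ C_{α,s,t} there exist a neighborhood U of x in C_{α,s,t} and a constant M>0 such that every harmonic map f: Δ → C_{α,s,t} with f(0) ∈ U satisfies ‖df(0)‖ < M. (By the tube-domain hyperbolicity criterion, this is equivalent to the Kobayashi hyperbolicity of the tube domain T_{C_{α,s,t}}.) -/
open Complex Metric Set Filter Topology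

/-- The base domain `C_{α,s,t}`: in polar coordinates, `s·e^{αφ} < r < t·e^{αφ}`. -/
def setC (α s t : ℝ) : Set (ℝ × ℝ) :=
  {x | ∃ r φ : ℝ, s * Real.exp (α * φ) < r ∧ r < t * Real.exp (α * φ) ∧
       x = (r * Real.cos φ, r * Real.sin φ)}

/-- The function is the real part of a holomorphic function. -/
lemma HarmonicOn.exists_holo {u : ℂ → ℝ} (hu : HarmonicOn u (ball (0 : ℂ) 1)) :
    ∃ F : ℂ → ℂ, DifferentiableOn ℂ F (ball (0 : ℂ) 1) ∧
      ∀ z ∈ ball (0 : ℂ) 1, u z = (F z).re := by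
  have hc : ∀ z ∈ ball (0 : ℂ) 1, ContDiffAt ℝ 2 u z := fun z hz =>
    hu.1.contDiffAt (isOpen_ball.mem_nhds hz)
  have key : InnerProductSpace.HarmonicOnNhd u (ball (0 : ℂ) 1) := by
    intro z hz
    refine ⟨hc z hz, ?_⟩
    filter_upwards [isOpen_ball.mem_nhds hz] with w hw
    have h2 := hu.2 w hw
    have hd : DifferentiableAt ℝ (fderiv ℝ u) w :=
      ((hc w hw).fderiv_right (m := 1) (by norm_num)).differentiableAt (by norm_num)
    rw [InnerProductSpace.laplacian_eq_iteratedFDeriv_complexPlane]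
    unfold laplacian at h2
    rw [fderiv_clm_apply hd (by fun_prop), fderiv_clm_apply hd (by fun_prop)] at h2
    simpa [iteratedFDeriv_two_apply] using h2
  obtain ⟨F, hF, h⟩ := key.exists_analyticOnNhd_ball_re_eq
  exact ⟨F, hF.differentiableOn, fun z hz => (h hz).symm⟩

/-- `p` is twice differentiable at `0` with first derivative `a`, second derivative `b`. -/
def Jet {E : Type*} [NormedAddCommGroup E] [NormedSpace ℝ E] (p : ℝ → E) (a b : E) : Prop :=
  ∃ p1 : ℝ → E, p1 0 = a ∧ (∀ᶠ τ in 𝓝 (0 : ℝ), HasDerivAt p (p1 τ) τ) ∧ HasDerivAt p1 b 0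

section jets
variable {E : Type*} [NormedAddCommGroup E] [NormedSpace ℝ E]

lemma Jet.continuousAt {p : ℝ → E} {a b : E} (h : Jet p a b) : ContinuousAt p 0 := by
  obtain ⟨p1, _, h1, _⟩ := h
  exact h1.self_of_nhds.continuousAt

lemma Jet.add {p q : ℝ → E} {a b c d : E} (hp : Jet p a b) (hq : Jet q c d) :
    Jet (fun τ => p τ + q τ) (a + c) (b + d) := by
  obtain ⟨p1, rfl, h1, h2⟩ := hp
  obtain ⟨q1, rfl, k1, k2⟩ := hq
  refine ⟨fun τ => p1 τ + q1 τ, rfl, ?_, h2.add k2⟩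
  filter_upwards [h1, k1] with τ a b using a.add b

lemma Jet.clm {F : Type*} [NormedAddCommGroup F] [NormedSpace ℝ F] {p : ℝ → E} {a b : E}
    (hp : Jet p a b) (l : E →L[ℝ] F) : Jet (fun τ => l (p τ)) (l a) (l b) := by
  obtain ⟨p1, rfl, h1, h2⟩ := hp
  refine ⟨fun τ => l (p1 τ), rfl, ?_, l.hasFDerivAt.comp_hasDerivAt _ h2⟩
  filter_upwards [h1] with τ a using l.hasFDerivAt.comp_hasDerivAt _ a

lemma Jet.const_mul {p : ℝ → ℝ} {a b : ℝ} (hp : Jet p a b) (c : ℝ) :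
    Jet (fun τ => c * p τ) (c * a) (c * b) := by
  obtain ⟨p1, rfl, h1, h2⟩ := hp
  refine ⟨fun τ => c * p1 τ, rfl, ?_, h2.const_mul c⟩
  filter_upwards [h1] with τ a using a.const_mul c

lemma Jet.exp {p : ℝ → ℝ} {a b : ℝ} (hp : Jet p a b) :
    Jet (fun τ => Real.exp (p τ)) (Real.exp (p 0) * a) (Real.exp (p 0) * (b + a ^ 2)) := by
  obtain ⟨p1, rfl, h1, h2⟩ := hp
  refine ⟨fun τ => Real.exp (p τ) * p1 τ, rfl, ?_, ?_⟩
  · filter_upwards [h1] with τ a using a.exp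
  · exact (h1.self_of_nhds.exp.mul h2).congr_deriv (by ring)

lemma Jet.log {p : ℝ → ℝ} {a b : ℝ} (hp : Jet p a b) (h0 : p 0 ≠ 0) :
    Jet (fun τ => Real.log (p τ)) (a / p 0) (b / p 0 - (a / p 0) ^ 2) := by
  have hc := hp.continuousAt
  obtain ⟨p1, rfl, h1, h2⟩ := hp
  refine ⟨fun τ => p1 τ / p τ, rfl, ?_, ?_⟩
  · filter_upwards [h1, hc.eventually_ne h0] with τ a b using a.log b
  · exact (h2.div h1.self_of_nhds h0).congr_deriv (by field_simp)

lemma Jet.clog {p : ℝ → ℂ} {a b : ℂ} (hp : Jet p a b) (h0 : p 0 ≠ 0) :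
    Jet (fun τ => Complex.log (p τ / p 0)) (a / p 0) (b / p 0 - (a / p 0) ^ 2) := by
  have hc := hp.continuousAt
  obtain ⟨p1, rfl, h1, h2⟩ := hp
  refine ⟨fun τ => p1 τ / p τ, rfl, ?_, ?_⟩
  · have hs : ∀ᶠ τ in 𝓝 (0 : ℝ), p τ / p 0 ∈ Complex.slitPlane := by
      have : ContinuousAt (fun τ => p τ / p 0) 0 := hc.div_const _
      apply this.eventually_mem
      apply Complex.isOpen_slitPlane.mem_nhds
      simp [div_self h0]
    filter_upwards [h1, hs, hc.eventually_ne h0] with τ a b c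
    exact ((a.div_const (p 0)).clog_real b).congr_deriv (by field_simp)
  · exact (h2.div h1.self_of_nhds h0).congr_deriv (by field_simp)

lemma Jet.nonpos {p : ℝ → ℝ} {a b : ℝ} (hp : Jet p a b) (hm : IsLocalMax p 0) : b ≤ 0 := by
  have hc := hp.continuousAt
  obtain ⟨p1, rfl, h1, h2⟩ := hp
  by_contra! hb
  have e : deriv p =ᶠ[𝓝 0] p1 := by filter_upwards [h1] with τ h using h.deriv
  have hdd : deriv (deriv p) 0 = b := by rw [e.deriv_eq]; exact h2.deriv
  have hmin := isLocalMin_of_deriv_deriv_pos (hdd ▸ hb) hm.deriv_eq_zero hc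
  have hconst : p =ᶠ[𝓝 0] fun _ => p 0 := by
    filter_upwards [hm, hmin] with τ a b using le_antisymm a b
  have : deriv (deriv p) 0 = 0 := by
    rw [hconst.deriv.deriv_eq]; simp
  linarith

lemma Jet.congr {p q : ℝ → E} {a b : E} (hp : Jet p a b) (h : p =ᶠ[𝓝 0] q) : Jet q a b := by
  obtain ⟨p1, rfl, h1, h2⟩ := hp
  refine ⟨p1, rfl, ?_, h2⟩
  filter_upwards [h1, h.eventually_nhds] with τ a b
  have b' : p =ᶠ[𝓝 τ] q := b
  exact a.congr_of_eventuallyEq b'.symm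

lemma line_tendsto (z d : ℂ) : Tendsto (fun τ : ℝ => z + τ * d) (𝓝 0) (𝓝 z) := by
  have : Continuous (fun τ : ℝ => z + τ * d) := by fun_prop
  simpa using this.tendsto 0

lemma Jet.holo {F : ℂ → ℂ} (hF : DifferentiableOn ℂ F (ball (0 : ℂ) 1)) {z : ℂ}
    (hz : z ∈ ball (0 : ℂ) 1) (d : ℂ) :
    Jet (fun τ : ℝ => F (z + τ * d)) (d * deriv F z) (d ^ 2 * deriv (deriv F) z) := by
  have hline : ∀ τ : ℝ, HasDerivAt (fun τ : ℝ => z + τ * d) d τ := by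
    intro τ
    simpa using ((Complex.ofRealCLM.hasDerivAt (x := τ)).mul_const d).const_add z
  have hF' := hF.deriv isOpen_ball
  refine ⟨fun τ => d * deriv F (z + τ * d), by simp, ?_, ?_⟩
  · filter_upwards [(line_tendsto z d).eventually (isOpen_ball.mem_nhds hz)] with τ hτ
    have := (hF.differentiableAt (isOpen_ball.mem_nhds hτ)).hasDerivAt
    exact (this.comp τ (hline τ)).congr_deriv (mul_comm _ _)
  · have h0 : z + ((0 : ℝ) : ℂ) * d = z := by simp
    have := (hF'.differentiableAt (isOpen_ball.mem_nhds hz)).hasDerivAt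
    rw [← h0] at this
    have := (this.comp 0 (hline 0)).const_mul d
    exact this.congr_deriv (by simp; ring)

end jets

/-- `h` has a spiral-polar representation with parameter `w`. -/
def SpP (α s t : ℝ) (h : ℂ) (w : ℝ) : Prop :=
  ∃ r φ : ℝ, h = r * Complex.exp (φ * I) ∧ w = r * Real.exp (-(α * φ)) ∧ s < w ∧ w < t

lemma SpP.aux {α s t : ℝ} (hα : 0 < α) (ht : 0 < t)
    (hst : Real.exp (-(2 * Real.pi * α)) * t < s) {r φ φ' : ℝ} {k : ℤ} (hk : 1 ≤ k)
    (hφ : φ = φ' + k * (2 * Real.pi)) (h1 : s < r * Real.exp (-(α * φ)))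
    (h2 : r * Real.exp (-(α * φ')) < t) : False := by
  have hk' : (1 : ℝ) ≤ k := by exact_mod_cast hk
  have e : r * Real.exp (-(α * φ)) =
      r * Real.exp (-(α * φ')) * Real.exp (-(2 * Real.pi * α * k)) := by
    rw [mul_assoc, ← Real.exp_add]; congr 2; rw [hφ]; ring
  have : Real.exp (-(2 * Real.pi * α * k)) ≤ Real.exp (-(2 * Real.pi * α)) := by
    apply Real.exp_le_exp.2
    have : 0 < 2 * Real.pi * α := by positivity
    nlinarith
  have h3 := Real.exp_pos (-(2 * Real.pi * α * k))
  nlinarith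

lemma SpP.unique {α s t : ℝ} (hα : 0 < α) (ht : 0 < t)
    (hst : Real.exp (-(2 * Real.pi * α)) * t < s) {h : ℂ} {w w' : ℝ}
    (h1 : SpP α s t h w) (h2 : SpP α s t h w') : w = w' := by
  obtain ⟨r, φ, e1, rfl, a1, a2⟩ := h1
  obtain ⟨r', φ', e2, rfl, b1, b2⟩ := h2
  have hs : 0 < s := lt_trans (by positivity) hst
  have hr : 0 < r := pos_of_mul_pos_left (hs.trans a1) (Real.exp_pos _).le
  have hr' : 0 < r' := pos_of_mul_pos_left (hs.trans b1) (Real.exp_pos _).le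
  have n1 : ‖h‖ = r := by rw [e1, norm_mul, Complex.norm_exp_ofReal_mul_I]; simp [abs_of_pos hr]
  have n2 : ‖h‖ = r' := by rw [e2, norm_mul, Complex.norm_exp_ofReal_mul_I]; simp [abs_of_pos hr']
  have hrr : r = r' := n1.symm.trans n2
  subst hrr
  have e3 : Complex.exp (φ * I) = Complex.exp (φ' * I) := by
    have : (r : ℂ) ≠ 0 := by exact_mod_cast hr.ne'
    exact mul_left_cancel₀ this (e1.symm.trans e2)
  obtain ⟨k, hk⟩ := Complex.exp_eq_exp_iff_exists_int.1 e3
  have hk' : φ = φ' + k * (2 * Real.pi) := by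
    have := congrArg Complex.im hk
    simpa using this
  rcases lt_trichotomy k 0 with hk0 | hk0 | hk0
  · exact (SpP.aux hα ht hst (k := -k) (by omega) (by push_cast; linarith) b1 a2).elim
  · subst hk0; simp at hk'; rw [hk']
  · exact (SpP.aux hα ht hst (k := k) (by omega) hk' a1 b2).elim

lemma SpP.ne_zero {α s t : ℝ} (hs : 0 < s) {h : ℂ} {w : ℝ}
    (h1 : SpP α s t h w) : h ≠ 0 := by
  obtain ⟨r, φ, e1, rfl, a1, a2⟩ := h1
  have hr : 0 < r := pos_of_mul_pos_left (hs.trans a1) (Real.exp_pos _).le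
  have : (r : ℂ) ≠ 0 := by exact_mod_cast hr.ne'
  rw [e1]
  exact mul_ne_zero this (Complex.exp_ne_zero _)

/-- local continuation of `w` -/
noncomputable def wloc (α w : ℝ) (h0 h : ℂ) : ℝ :=
  w * Real.exp (((1 + α * I) * Complex.log (h / h0)).re)

lemma wloc_continuousAt {α w : ℝ} {h0 : ℂ} (h : h0 ≠ 0) : ContinuousAt (wloc α w h0) h0 := by
  unfold wloc
  have : ContinuousAt (fun h : ℂ => Complex.log (h / h0)) h0 := by
    apply ContinuousAt.clog (by fun_prop)
    simp [div_self h]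
  have h2 : ContinuousAt (fun h : ℂ => ((1 + α * I) * Complex.log (h / h0)).re) h0 :=
    Complex.continuous_re.continuousAt.comp (continuousAt_const.mul this)
  exact continuousAt_const.mul (Real.continuous_exp.continuousAt.comp h2)

lemma SpP.loc {α s t : ℝ} (hs : 0 < s) {h0 : ℂ} {w : ℝ}
    (h1 : SpP α s t h0 w) : ∀ᶠ h in 𝓝 h0, SpP α s t h (wloc α w h0 h) := by
  have hne := h1.ne_zero hs
  obtain ⟨r, φ, e1, rfl, a1, a2⟩ := h1
  have hr : 0 < r := pos_of_mul_pos_left (hs.trans a1) (Real.exp_pos _).le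
  have n1 : ‖h0‖ = r := by rw [e1, norm_mul, Complex.norm_exp_ofReal_mul_I]; simp [abs_of_pos hr]
  have hc := wloc_continuousAt (α := α) (w := r * Real.exp (-(α * φ))) hne
  have hv : wloc α (r * Real.exp (-(α * φ))) h0 h0 = r * Real.exp (-(α * φ)) := by
    simp [wloc, div_self hne]
  filter_upwards [hc.eventually_const_lt (hv ▸ a1), hc.eventually_lt_const (hv ▸ a2),
    continuousAt_id.eventually_ne hne] with h b1 b2 b3
  simp only [id] at b3
  refine ⟨‖h‖, φ + Complex.arg (h / h0), ?_, ?_, b1, b2⟩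
  · have e2 : h / h0 = ‖h / h0‖ * Complex.exp (Complex.arg (h / h0) * I) :=
      (Complex.norm_mul_exp_arg_mul_I _).symm
    have e3 : h = h0 * (h / h0) := by field_simp
    have : (r : ℂ) ≠ 0 := by exact_mod_cast hr.ne'
    have e4 : (‖h‖ : ℂ) = r * (‖h / h0‖ : ℝ) := by
      rw [norm_div, n1]; push_cast; field_simp
    rw [e4]
    push_cast
    rw [add_mul, Complex.exp_add]
    calc h = h0 * (h / h0) := e3
      _ = (r * Complex.exp (φ * I)) * (‖h / h0‖ * Complex.exp (Complex.arg (h / h0) * I)) := by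
        rw [← e1, ← e2]
      _ = _ := by ring
  · have hp : 0 < ‖h / h0‖ := by simp [hne, b3]
    have e3 : ‖h‖ = r * ‖h / h0‖ := by rw [norm_div, n1]; field_simp
    unfold wloc
    simp only [Complex.mul_re, Complex.add_re, Complex.one_re, Complex.ofReal_re, Complex.I_re,
      Complex.add_im, Complex.one_im, Complex.mul_im, Complex.ofReal_im, Complex.I_im,
      Complex.log_re, Complex.log_im]
    rw [e3]
    have : (1 + (α * 0 - 0 * 1)) * Real.log ‖h / h0‖ - (0 + (α * 1 + 0 * 0)) * (h / h0).arg
      = Real.log ‖h / h0‖ + -(α * (h / h0).arg) := by ring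
    rw [this, Real.exp_add, Real.exp_log hp, mul_add, neg_add, Real.exp_add]
    ring

lemma mem_setC_iff {α s t : ℝ} {x : ℝ × ℝ} :
    x ∈ setC α s t ↔ ∃ w, SpP α s t ((x.1 : ℂ) + x.2 * I) w := by
  have key : ∀ r φ : ℝ, ((x.1 : ℂ) + x.2 * I = r * Complex.exp (φ * I)) ↔
      x = (r * Real.cos φ, r * Real.sin φ) := by
    intro r φ
    rw [Complex.exp_mul_I, Complex.ext_iff, Prod.ext_iff]
    simp [← Complex.ofReal_cos, ← Complex.ofReal_sin]
  have k2 : ∀ φ : ℝ, Real.exp (-(α * φ)) = (Real.exp (α * φ))⁻¹ := fun φ => Real.exp_neg _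
  constructor
  · rintro ⟨r, φ, h1, h2, h3⟩
    refine ⟨_, r, φ, (key r φ).2 h3, rfl, ?_, ?_⟩
    · rw [k2, ← div_eq_mul_inv, lt_div_iff₀ (Real.exp_pos _)]; exact h1
    · rw [k2, ← div_eq_mul_inv, div_lt_iff₀ (Real.exp_pos _)]; exact h2
  · rintro ⟨w, r, φ, h1, rfl, h2, h3⟩
    refine ⟨r, φ, ?_, ?_, (key r φ).1 h1⟩
    · rwa [k2, ← div_eq_mul_inv, lt_div_iff₀ (Real.exp_pos _)] at h2
    · rwa [k2, ← div_eq_mul_inv, div_lt_iff₀ (Real.exp_pos _)] at h3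

lemma setC_mem_nhds {α s t : ℝ} (hs : 0 < s) {x : ℝ × ℝ} (hx : x ∈ setC α s t) :
    setC α s t ∈ 𝓝 x := by
  obtain ⟨w, hw⟩ := mem_setC_iff.1 hx
  have hc : Continuous (fun y : ℝ × ℝ => (y.1 : ℂ) + y.2 * I) := by fun_prop
  filter_upwards [(hc.tendsto x).eventually (hw.loc hs)] with y hy
  exact mem_setC_iff.2 ⟨_, hy⟩

lemma alg_ineq (α κ : ℝ) (hκ : 3 ≤ κ) (q : ℂ) :
    ‖q‖ ^ 2 ≤ 2 * (q ^ 2).re + κ * (2 * ((1 + α * I) * -q ^ 2).re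
      + (2 * ((1 + α * I) * q).re) ^ 2) := by
  obtain ⟨x, y⟩ := q
  rw [← Complex.normSq_eq_norm_sq, Complex.normSq_mk]
  simp only [pow_two, Complex.mul_re, Complex.mul_im, Complex.add_re, Complex.add_im,
    Complex.one_re, Complex.one_im, Complex.ofReal_re, Complex.ofReal_im, Complex.I_re,
    Complex.I_im, Complex.neg_re, Complex.neg_im]
  have h1 : x * x + y * y ≤ 2 * ((x - α * y) ^ 2 + (1 + α ^ 2) * y ^ 2) := by
    nlinarith [sq_nonneg (x - 2 * α * y), sq_nonneg y]
  have h2 : 0 ≤ (κ - 3) * ((x - α * y) ^ 2 + (1 + α ^ 2) * y ^ 2) :=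
    mul_nonneg (by linarith) (by positivity)
  nlinarith [sq_nonneg x, sq_nonneg y]

lemma dir_ineq {α κ : ℝ} (hκ : 3 ≤ κ) {h G : ℝ → ℂ} {N : ℝ → ℝ} {a b c e : ℂ} {n1 n2 : ℝ}
    (hh : Jet h a b) (hG : Jet G c e) (hN : Jet N n1 n2) (h0 : h 0 ≠ 0) (G0 : G 0 ≠ 0)
    (N0 : N 0 ≠ 0)
    (hm : IsLocalMax (fun τ => 2 * (Complex.log (G τ / G 0)).re
      + (-2) * (Complex.log (h τ / h 0)).re
      + κ * Real.exp (2 * ((1 + α * I) * Complex.log (h τ / h 0)).re)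
      + 2 * Real.log (N τ)) 0) :
    2 * (e / G 0 - (c / G 0) ^ 2).re - 2 * (b / h 0).re
      + 2 * κ * ((1 + α * I) * (b / h 0)).re + ‖a / h 0‖ ^ 2
      + 2 * (n2 / N 0 - (n1 / N 0) ^ 2) ≤ 0 := by
  have hL := hh.clog h0
  have J1 := ((hG.clog G0).clm Complex.reCLM).const_mul 2
  have J2 := (hL.clm Complex.reCLM).const_mul (-2)
  have J3 := ((((hL.clm (Complex.reCLM.comp
    ((ContinuousLinearMap.mul ℝ ℂ) (1 + α * I)))).const_mul 2)).exp).const_mul κ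
  have J4 := (hN.log N0).const_mul 2
  have J := ((J1.add J2).add J3).add J4
  simp only [ContinuousLinearMap.comp_apply, ContinuousLinearMap.mul_apply', Complex.reCLM_apply]
    at J
  have hn := J.nonpos hm
  have ha := alg_ineq α κ hκ (a / h 0)
  rw [div_self h0, Complex.log_one, mul_zero, Complex.zero_re, mul_zero, Real.exp_zero,
    sub_eq_add_neg (b / h 0), mul_add (1 + (α : ℂ) * I), Complex.add_re, Complex.add_re] at hn
  have hneg : (-(a / h 0) ^ 2).re = - ((a / h 0) ^ 2).re := Complex.neg_re _
  rw [hneg] at hn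
  linarith

lemma jet_N (R : ℝ) (z d : ℂ) :
    Jet (fun τ : ℝ => R ^ 2 - ‖z + τ * d‖ ^ 2) (-2 * (z.re * d.re + z.im * d.im))
      (-2 * ‖d‖ ^ 2) := by
  have e : ∀ w : ℂ, ‖w‖ ^ 2 = w.re ^ 2 + w.im ^ 2 := by
    intro w; rw [← Complex.normSq_eq_norm_sq, Complex.normSq_apply]; ring
  refine ⟨fun τ => -2 * ((z.re + τ * d.re) * d.re + (z.im + τ * d.im) * d.im), by simp, ?_, ?_⟩
  · refine Filter.Eventually.of_forall fun τ => ?_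
    have h1 : HasDerivAt (fun τ : ℝ => z.re + τ * d.re) d.re τ := by
      simpa using ((hasDerivAt_id τ).mul_const d.re).const_add z.re
    have h2 : HasDerivAt (fun τ : ℝ => z.im + τ * d.im) d.im τ := by
      simpa using ((hasDerivAt_id τ).mul_const d.im).const_add z.im
    have h3 := ((h1.pow 2).add (h2.pow 2)).const_sub (R ^ 2)
    have e2 : (fun τ : ℝ => R ^ 2 - ‖z + τ * d‖ ^ 2) =
        fun τ : ℝ => R ^ 2 - ((z.re + τ * d.re) ^ 2 + (z.im + τ * d.im) ^ 2) := by
      funext τ; rw [e]; simp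
    rw [e2]
    exact h3.congr_deriv (by push_cast; ring)
  · have h1 : HasDerivAt (fun τ : ℝ => z.re + τ * d.re) d.re 0 := by
      simpa using ((hasDerivAt_id (0 : ℝ)).mul_const d.re).const_add z.re
    have h2 : HasDerivAt (fun τ : ℝ => z.im + τ * d.im) d.im 0 := by
      simpa using ((hasDerivAt_id (0 : ℝ)).mul_const d.im).const_add z.im
    have h3 := ((h1.mul_const d.re).add (h2.mul_const d.im)).const_mul (-2)
    refine h3.congr_deriv ?_
    rw [e]; ring

lemma jet_h {F₁ F₂ : ℂ → ℂ} (hF₁ : DifferentiableOn ℂ F₁ (ball (0 : ℂ) 1))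
    (hF₂ : DifferentiableOn ℂ F₂ (ball (0 : ℂ) 1)) {z : ℂ} (hz : z ∈ ball (0 : ℂ) 1) (d : ℂ) :
    Jet (fun τ : ℝ => ((F₁ (z + τ * d)).re : ℂ) + (F₂ (z + τ * d)).re * I)
      (((d * deriv F₁ z).re : ℂ) + (d * deriv F₂ z).re * I)
      (((d ^ 2 * deriv (deriv F₁) z).re : ℂ) + (d ^ 2 * deriv (deriv F₂) z).re * I) := by
  have J1 := ((Jet.holo hF₁ hz d).clm Complex.reCLM).clm Complex.ofRealCLM
  have J2 := (((Jet.holo hF₂ hz d).clm Complex.reCLM).clm Complex.ofRealCLM).clm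
    ((ContinuousLinearMap.mul ℝ ℂ).flip I)
  exact J1.add J2

/-- At an interior maximum the density is controlled. -/
lemma at_max {α κ R : ℝ} (hκ : 3 ≤ κ) {F₁ F₂ G : ℂ → ℂ}
    (hF₁ : DifferentiableOn ℂ F₁ (ball (0 : ℂ) 1))
    (hF₂ : DifferentiableOn ℂ F₂ (ball (0 : ℂ) 1)) (hG : DifferentiableOn ℂ G (ball (0 : ℂ) 1))
    {z : ℂ} (hz : z ∈ ball (0 : ℂ) 1)
    (hGle : ‖G z‖ ^ 2 ≤ ‖deriv F₁ z‖ ^ 2 + ‖deriv F₂ z‖ ^ 2)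
    {h : ℂ → ℂ} (hh : h = fun z => ((F₁ z).re : ℂ) + (F₂ z).re * I)
    (h0 : h z ≠ 0) (G0 : G z ≠ 0) (N0 : 0 < R ^ 2 - ‖z‖ ^ 2)
    (hm : IsLocalMax (fun w => 2 * (Complex.log (G w / G z)).re
      + (-2) * (Complex.log (h w / h z)).re
      + κ * Real.exp (2 * ((1 + α * I) * Complex.log (h w / h z)).re)
      + 2 * Real.log (R ^ 2 - ‖w‖ ^ 2)) z) :
    ‖G z‖ ^ 2 / ‖h z‖ ^ 2 * (R ^ 2 - ‖z‖ ^ 2) ^ 2 ≤ 8 * R ^ 2 := by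
  have key : ∀ d : ℂ, _ := fun d => dir_ineq (α := α) hκ (jet_h hF₁ hF₂ hz d)
    (Jet.holo hG hz d) (jet_N R z d)
    (by simpa [hh] using h0) (by simpa using G0) (by simpa using N0.ne')
    (by
      have := (line_tendsto z d).eventually hm
      simp only [hh] at this
      filter_upwards [this] with τ hτ
      simpa using hτ)
  have k1 := key 1
  have k2 := key I
  simp only [Complex.ofReal_zero, zero_mul, add_zero] at k1 k2
  have hh' : ∀ w, ((F₁ w).re : ℂ) + (F₂ w).re * I = h w := fun w => by rw [hh]
  rw [hh'] at k1 k2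
  set A := deriv F₁ z
  set B := deriv F₂ z
  have eb : (((I ^ 2 * deriv (deriv F₁) z).re : ℂ) + (I ^ 2 * deriv (deriv F₂) z).re * I) / h z
    = - ((((1 ^ 2 * deriv (deriv F₁) z).re : ℂ) + (1 ^ 2 * deriv (deriv F₂) z).re * I) / h z) := by
    simp; ring
  have eg : I ^ 2 * deriv (deriv G) z / G z - (I * deriv G z / G z) ^ 2 =
      - (1 ^ 2 * deriv (deriv G) z / G z - (1 * deriv G z / G z) ^ 2) := by
    rw [mul_div_assoc, mul_div_assoc, mul_pow, Complex.I_sq]; ring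
  rw [eb, eg, mul_neg, Complex.neg_re, Complex.neg_re, Complex.neg_re] at k2
  have nsq : ∀ x y : ℝ, ‖(x : ℂ) + y * I‖ ^ 2 = x ^ 2 + y ^ 2 := by
    intro x y; rw [← Complex.normSq_eq_norm_sq, Complex.normSq_add_mul_I]
  have e : ∀ w : ℂ, ‖w‖ ^ 2 = w.re ^ 2 + w.im ^ 2 := by
    intro w; rw [← Complex.normSq_eq_norm_sq, Complex.normSq_apply]; ring
  rw [norm_div, div_pow ‖_‖, nsq] at k1 k2
  have hpos : 0 < ‖h z‖ ^ 2 := by positivity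
  set P := ‖h z‖ ^ 2
  have hsum : (‖A‖ ^ 2 + ‖B‖ ^ 2) / P ≤ 8 * R ^ 2 / (R ^ 2 - ‖z‖ ^ 2) ^ 2 := by
    have t1 : (‖A‖ ^ 2 + ‖B‖ ^ 2) / P = ((1 * A).re ^ 2 + (1 * B).re ^ 2) / P
      + ((I * A).re ^ 2 + (I * B).re ^ 2) / P := by
      rw [e A, e B]; simp; ring
    have t2 : 8 * R ^ 2 / (R ^ 2 - ‖z‖ ^ 2) ^ 2 =
      - (2 * (-2 * ‖(1 : ℂ)‖ ^ 2 / (R ^ 2 - ‖z‖ ^ 2) -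
          (-2 * (z.re * (1 : ℂ).re + z.im * (1 : ℂ).im) / (R ^ 2 - ‖z‖ ^ 2)) ^ 2))
      - (2 * (-2 * ‖I‖ ^ 2 / (R ^ 2 - ‖z‖ ^ 2) -
          (-2 * (z.re * I.re + z.im * I.im) / (R ^ 2 - ‖z‖ ^ 2)) ^ 2)) := by
      have := N0.ne'
      simp only [norm_one, Complex.norm_I, Complex.one_re, Complex.one_im, Complex.I_re,
        Complex.I_im]
      field_simp
      rw [e z]; ring
    rw [t1, t2]
    linarith
  have h3 : ‖G z‖ ^ 2 / P ≤ 8 * R ^ 2 / (R ^ 2 - ‖z‖ ^ 2) ^ 2 :=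
    (div_le_div_of_nonneg_right hGle hpos.le).trans hsum
  rwa [le_div_iff₀ (by positivity)] at h3

lemma G_bound {α s t : ℝ} (hα : 0 < α) (ht : 0 < t)
    (hst : Real.exp (-(2 * Real.pi * α)) * t < s) {F₁ F₂ G : ℂ → ℂ}
    (hF₁ : DifferentiableOn ℂ F₁ (ball (0 : ℂ) 1))
    (hF₂ : DifferentiableOn ℂ F₂ (ball (0 : ℂ) 1)) (hG : DifferentiableOn ℂ G (ball (0 : ℂ) 1))
    (hGle : ∀ z, ‖G z‖ ^ 2 ≤ ‖deriv F₁ z‖ ^ 2 + ‖deriv F₂ z‖ ^ 2)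
    {h : ℂ → ℂ} (hh : h = fun z => ((F₁ z).re : ℂ) + (F₂ z).re * I)
    (hmap : ∀ z ∈ ball (0 : ℂ) 1, ∃ w, SpP α s t (h z) w) :
    ‖G 0‖ ^ 2 ≤ 32 * Real.exp (3 / s ^ 2 * t ^ 2) * ‖h 0‖ ^ 2 := by
  have hs : 0 < s := lt_trans (by positivity) hst
  by_cases hG0 : G 0 = 0
  · rw [hG0]; simp; positivity
  have hmap' : ∀ z : ℂ, ∃ w, z ∈ ball (0 : ℂ) 1 → SpP α s t (h z) w := by
    intro z
    by_cases hz : z ∈ ball (0 : ℂ) 1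
    · obtain ⟨w, hw⟩ := hmap z hz; exact ⟨w, fun _ => hw⟩
    · exact ⟨0, fun h => (hz h).elim⟩
  choose W hW using hmap'
  have hWb : ∀ z ∈ ball (0 : ℂ) 1, s < W z ∧ W z < t := by
    intro z hz
    obtain ⟨_, _, _, _, a, b⟩ := hW z hz
    exact ⟨a, b⟩
  have hne : ∀ z ∈ ball (0 : ℂ) 1, h z ≠ 0 := fun z hz => (hW z hz).ne_zero hs
  have hhc : ∀ z ∈ ball (0 : ℂ) 1, ContinuousAt h z := by
    intro z hz
    have c1 := hF₁.continuousOn.continuousAt (isOpen_ball.mem_nhds hz)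
    have c2 := hF₂.continuousOn.continuousAt (isOpen_ball.mem_nhds hz)
    rw [hh]
    fun_prop
  have hWloc : ∀ z ∈ ball (0 : ℂ) 1, W =ᶠ[𝓝 z] fun y => wloc α (W z) (h z) (h y) := by
    intro z hz
    filter_upwards [(hhc z hz).eventually ((hW z hz).loc hs), isOpen_ball.mem_nhds hz] with y h1 h2
    exact (hW y h2).unique hα ht hst h1
  have hWc : ∀ z ∈ ball (0 : ℂ) 1, ContinuousAt W z := by
    intro z hz
    refine ContinuousAt.congr ?_ (hWloc z hz).symm
    exact ContinuousAt.comp (g := wloc α (W z) (h z)) (wloc_continuousAt (hne z hz)) (hhc z hz)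
  set K := 3 / s ^ 2 with hK
  have hKpos : 0 < K := by positivity
  set ρ : ℂ → ℝ := fun z => ‖G z‖ ^ 2 / ‖h z‖ ^ 2 * Real.exp (K * W z ^ 2) *
    ((1 / 2 : ℝ) ^ 2 - ‖z‖ ^ 2) ^ 2 with hρ
  have hsub : closedBall (0 : ℂ) (1 / 2) ⊆ ball 0 1 := closedBall_subset_ball (by norm_num)
  have hρc : ContinuousOn ρ (closedBall (0 : ℂ) (1 / 2)) := by
    intro z hz
    have hz' := hsub hz
    apply ContinuousAt.continuousWithinAt
    have c1 := hG.continuousOn.continuousAt (isOpen_ball.mem_nhds hz')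
    have c2 := hhc z hz'
    have c3 := hWc z hz'
    have c4 : ‖h z‖ ^ 2 ≠ 0 := by have := hne z hz'; positivity
    have c5 : ContinuousAt (fun z => ‖G z‖ ^ 2 / ‖h z‖ ^ 2) z :=
      (c1.norm.pow 2).div (c2.norm.pow 2) c4
    fun_prop
  obtain ⟨z, hz, hmax⟩ := (isCompact_closedBall (0 : ℂ) (1 / 2)).exists_isMaxOn
    ⟨0, by simp⟩ hρc
  have hz' := hsub hz
  have h0b : (0 : ℂ) ∈ ball (0 : ℂ) 1 := by simp
  have hρ0 : ρ 0 ≤ ρ z := hmax (by simp)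
  have hρ0pos : 0 < ρ 0 := by
    have := hne 0 h0b
    simp only [hρ, norm_zero]
    positivity
  have hρz : 0 < ρ z := hρ0pos.trans_le hρ0
  have hGz : G z ≠ 0 := by
    intro hc; simp [hρ, hc] at hρz
  have hNne : (1 / 2 : ℝ) ^ 2 - ‖z‖ ^ 2 ≠ 0 := by
    intro hc; simp only [hρ, hc] at hρz; simp at hρz
  have hzle : ‖z‖ ≤ 1 / 2 := by simpa using hz
  have hN : 0 < (1 / 2 : ℝ) ^ 2 - ‖z‖ ^ 2 := by
    refine lt_of_le_of_ne ?_ hNne.symm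
    nlinarith [norm_nonneg z]
  have hzlt : ‖z‖ < 1 / 2 := by
    refine lt_of_le_of_ne hzle fun hc => hNne (by rw [hc]; ring)
  have hκ : 3 ≤ K * W z ^ 2 := by
    have h1 := (hWb z hz').1
    have h2 : s ^ 2 ≤ W z ^ 2 := by gcongr
    calc (3 : ℝ) = K * s ^ 2 := by rw [hK]; field_simp
      _ ≤ _ := by gcongr
  have hbd := at_max (α := α) (R := 1 / 2) hκ hF₁ hF₂ hG hz' (hGle z) hh (hne z hz') hGz hN (by
    have hnb : ball (0 : ℂ) (1 / 2) ∈ 𝓝 z := isOpen_ball.mem_nhds (by simpa using hzlt)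
    have cG := hG.continuousOn.continuousAt (isOpen_ball.mem_nhds hz')
    have hval : ∀ y, y ∈ ball (0 : ℂ) (1 / 2) → G y ≠ 0 →
        W y = wloc α (W z) (h z) (h y) →
        2 * (Complex.log (G y / G z)).re
        + (-2) * (Complex.log (h y / h z)).re
        + K * W z ^ 2 * Real.exp (2 * ((1 + α * I) * Complex.log (h y / h z)).re)
        + 2 * Real.log ((1 / 2) ^ 2 - ‖y‖ ^ 2) =
        Real.log (ρ y) - 2 * Real.log ‖G z‖ + 2 * Real.log ‖h z‖ := by
      intro y hy hGy hWy
      have hy1 : y ∈ ball (0 : ℂ) 1 := hsub (ball_subset_closedBall hy)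
      have hy2 : ‖y‖ < 1 / 2 := by simpa using hy
      have hNy : 0 < (1 / 2 : ℝ) ^ 2 - ‖y‖ ^ 2 := by nlinarith [norm_nonneg y]
      have n1 : ‖G y‖ ≠ 0 := norm_ne_zero_iff.2 hGy
      have n2 : ‖h y‖ ≠ 0 := norm_ne_zero_iff.2 (hne y hy1)
      have n3 : ‖G z‖ ≠ 0 := norm_ne_zero_iff.2 hGz
      have n4 : ‖h z‖ ≠ 0 := norm_ne_zero_iff.2 (hne z hz')
      have eW : W z ^ 2 * Real.exp (2 * ((1 + α * I) * Complex.log (h y / h z)).re)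
          = W y ^ 2 := by
        rw [hWy, wloc, mul_pow, ← Real.exp_nat_mul]; norm_num
      rw [mul_assoc K, eW]
      simp only [hρ]
      rw [Real.log_mul (by positivity) (by positivity), Real.log_mul (by positivity)
        (by positivity), Real.log_div (by positivity) (by positivity), Real.log_exp,
        Real.log_pow, Real.log_pow, Real.log_pow, Complex.log_re, Complex.log_re, norm_div,
        norm_div, Real.log_div n1 n3, Real.log_div n2 n4]
      push_cast
      ring
    filter_upwards [hnb, cG.eventually_ne hGz, hWloc z hz'] with y hy1 hy2 hy3
    rw [hval y hy1 hy2 hy3, hval z (by simpa using hzlt) hGz (hWloc z hz').self_of_nhds]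
    have hle : ρ y ≤ ρ z := hmax (ball_subset_closedBall hy1)
    have hyp : 0 < ρ y := by
      have hy1' : y ∈ ball (0 : ℂ) 1 := hsub (ball_subset_closedBall hy1)
      have := hne y hy1'
      have hy2 : ‖y‖ < 1 / 2 := by simpa using hy1
      have hNy : 0 < (1 / 2 : ℝ) ^ 2 - ‖y‖ ^ 2 := by nlinarith [norm_nonneg y]
      simp only [hρ]
      positivity
    have := Real.log_le_log hyp hle
    linarith)
  have hexp : Real.exp (K * W z ^ 2) ≤ Real.exp (K * t ^ 2) := by
    apply Real.exp_le_exp.2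
    have h1 := hWb z hz'
    have : 0 < W z := hs.trans h1.1
    have := h1.2
    gcongr
  have hup : ρ z ≤ 2 * Real.exp (K * t ^ 2) := by
    calc ρ z = ‖G z‖ ^ 2 / ‖h z‖ ^ 2 * ((1 / 2 : ℝ) ^ 2 - ‖z‖ ^ 2) ^ 2
          * Real.exp (K * W z ^ 2) := by simp only [hρ]; ring
      _ ≤ (8 * (1 / 2) ^ 2) * Real.exp (K * t ^ 2) := by gcongr
      _ = _ := by ring
  have hlow : ‖G 0‖ ^ 2 / ‖h 0‖ ^ 2 * (1 / 16) ≤ ρ 0 := by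
    simp only [hρ, norm_zero]
    have : 1 ≤ Real.exp (K * W 0 ^ 2) := Real.one_le_exp (by positivity)
    calc ‖G 0‖ ^ 2 / ‖h 0‖ ^ 2 * (1 / 16) = ‖G 0‖ ^ 2 / ‖h 0‖ ^ 2 * 1 *
          ((1 / 2 : ℝ) ^ 2 - 0 ^ 2) ^ 2 := by ring
      _ ≤ _ := by gcongr
  have hfin : ‖G 0‖ ^ 2 / ‖h 0‖ ^ 2 ≤ 32 * Real.exp (K * t ^ 2) := by linarith
  have := hne 0 h0b
  rwa [div_le_iff₀ (by positivity)] at hfin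

/-- Harmonic-map hyperbolicity criterion for `C_{α,s,t}`: every point of the base has
a neighborhood on which derivatives at `0` of harmonic maps from the unit disk into
the base are uniformly bounded. -/
theorem baseC_harmonic_hyperbolic (α s t : ℝ) (hα : 0 < α) (ht : 0 < t)
    (hst : Real.exp (-(2 * Real.pi * α)) * t < s) (hst' : s < t)
    (x : ℝ × ℝ) (hx : x ∈ setC α s t) :
    ∃ U ⊆ setC α s t, U ∈ 𝓝 x ∧ ∃ M > (0 : ℝ),
      ∀ f : ℂ → ℝ × ℝ, HarmonicMapOn f (ball (0 : ℂ) 1) →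
        MapsTo f (ball (0 : ℂ) 1) (setC α s t) → f 0 ∈ U →
          ‖fderiv ℝ f 0‖ < M := by
  have hs : 0 < s := lt_trans (by positivity) hst
  set c := 32 * Real.exp (3 / s ^ 2 * t ^ 2) * (2 * (‖x‖ + 1)) ^ 2 with hc
  have hcpos : 0 < c := by positivity
  refine ⟨setC α s t ∩ ball x 1, inter_subset_left,
    Filter.inter_mem (setC_mem_nhds hs hx) (ball_mem_nhds x one_pos), Real.sqrt c + 1,
    by positivity, ?_⟩
  intro f hf hmaps hf0
  obtain ⟨F₁, hF₁, e₁⟩ := hf.1.exists_holo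
  obtain ⟨F₂, hF₂, e₂⟩ := hf.2.exists_holo
  have h0b : (0 : ℂ) ∈ ball (0 : ℂ) 1 := by simp
  have hmap : ∀ z ∈ ball (0 : ℂ) 1, ∃ w, SpP α s t (((F₁ z).re : ℂ) + (F₂ z).re * I) w := by
    intro z hz
    have := mem_setC_iff.1 (hmaps hz)
    rwa [e₁ z hz, e₂ z hz] at this
  have hnorm : ‖((F₁ 0).re : ℂ) + (F₂ 0).re * I‖ ≤ 2 * (‖x‖ + 1) := by
    have h1 : ‖f 0‖ ≤ ‖x‖ + 1 := by
      have h2 : ‖f 0 - x‖ < 1 := by simpa [dist_eq_norm] using hf0.2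
      have h3 := norm_sub_norm_le (f 0) x
      linarith
    have h2 := norm_fst_le (f 0)
    have h3 := norm_snd_le (f 0)
    rw [e₁ 0 h0b] at h2
    rw [e₂ 0 h0b] at h3
    have h4 := norm_add_le ((F₁ 0).re : ℂ) ((F₂ 0).re * I)
    rw [norm_mul, Complex.norm_I, Complex.norm_real, Complex.norm_real] at h4
    linarith
  have bnd : ∀ G : ℂ → ℂ, DifferentiableOn ℂ G (ball (0 : ℂ) 1) →
      (∀ z, ‖G z‖ ^ 2 ≤ ‖deriv F₁ z‖ ^ 2 + ‖deriv F₂ z‖ ^ 2) → ‖G 0‖ ≤ Real.sqrt c := by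
    intro G hG hle
    apply Real.le_sqrt_of_sq_le
    refine (G_bound hα ht hst hF₁ hF₂ hG hle rfl hmap).trans ?_
    rw [hc]
    gcongr
  have b₁ := bnd _ (hF₁.deriv isOpen_ball) fun z => by
    have := sq_nonneg ‖deriv F₂ z‖; linarith
  have b₂ := bnd _ (hF₂.deriv isOpen_ball) fun z => by
    have := sq_nonneg ‖deriv F₁ z‖; linarith
  have d₁ := ((hF₁.differentiableAt (isOpen_ball.mem_nhds h0b)).hasDerivAt.hasFDerivAt).restrictScalars ℝ
  have d₂ := ((hF₂.differentiableAt (isOpen_ball.mem_nhds h0b)).hasDerivAt.hasFDerivAt).restrictScalars ℝ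
  have D := (Complex.reCLM.hasFDerivAt.comp 0 d₁).prodMk (Complex.reCLM.hasFDerivAt.comp 0 d₂)
  have hfe : f =ᶠ[𝓝 0] fun z => ((F₁ z).re, (F₂ z).re) := by
    filter_upwards [isOpen_ball.mem_nhds h0b] with z hz
    exact Prod.ext (e₁ z hz) (e₂ z hz)
  have D' : HasFDerivAt f _ 0 := HasFDerivAt.congr_of_eventuallyEq D hfe
  rw [D'.fderiv]
  refine lt_of_le_of_lt (ContinuousLinearMap.opNorm_le_bound _ (Real.sqrt_nonneg c) ?_)
    (lt_add_one _)
  intro d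
  have aux : ∀ a : ℂ, ‖a‖ ≤ Real.sqrt c → ‖(d * a).re‖ ≤ Real.sqrt c * ‖d‖ := by
    intro a ha
    calc ‖(d * a).re‖ ≤ ‖d * a‖ := Complex.abs_re_le_norm _
      _ = ‖a‖ * ‖d‖ := by rw [norm_mul, mul_comm]
      _ ≤ _ := by gcongr
  rw [Prod.norm_def]
  apply max_le
  · simpa using aux _ b₁
  · simpa using aux _ b₂
end

section
/- Let g₁, g₂: ℝ → (0,∞) be continuous increasing functions with g_i(φ) → 0 as φ → −∞ and g_i(φ) → ∞ as φ → +∞ (i=1,2), and suppose g₁(φ) < g₂(φ) ≤ g₁(φ+2π) for all φ ∈ ℝ. Set D = {(r·cos φ, r·sin φ) : φ ∈ ℝ, g₁(φ) < r < g₂(φ)} (the domain bounded by the two spirals r = g₁(φ) and r = g₂(φ)). Then for every point x ∈ D there exist a neighborhood U of x in D and a constant M>0 such that every harmonic map f: Δ → D with f(0) ∈ U satisfies ‖df(0)‖ < M; i.e., the tube domain T_D is Kobayashi-hyperbolic. -/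
open Complex Metric Set Filter Topology

lemma maxprin (E : ℂ → ℝ) (s : ℝ) (hs : 0 < s) (hE : ContinuousOn E (closedBall 0 s))
    (hk : ∀ z₀ ∈ ball (0:ℂ) s, ∃ k : ℂ → ℂ × ℂ, (∀ᶠ z in 𝓝 z₀, DifferentiableAt ℂ k z) ∧
      ‖k z₀‖ = E z₀ ∧ ∀ᶠ z in 𝓝 z₀, ‖k z‖ ≤ E z)
    (Bd : ℝ) (hB : ∀ z ∈ sphere (0:ℂ) s, E z ≤ Bd) : E 0 ≤ Bd := by
  obtain ⟨zm, hzm, hmax⟩ := (isCompact_closedBall (0:ℂ) s).exists_isMaxOn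
    ⟨0, mem_closedBall_self hs.le⟩ hE
  have h0 : E 0 ≤ E zm := hmax (mem_closedBall_self hs.le)
  by_contra hcon
  push Not at hcon
  have hEm : Bd < E zm := hcon.trans_le h0
  set Z : Set ℂ := closedBall 0 s ∩ E ⁻¹' {E zm} with hZ
  have hZc : IsClosed Z := hE.preimage_isClosed_of_isClosed isClosed_closedBall isClosed_singleton
  have hZb : Z ⊆ ball 0 s := by
    rintro z ⟨hz1, hz2⟩
    rw [mem_closedBall_zero_iff] at hz1
    rw [mem_ball_zero_iff]
    refine lt_of_le_of_ne hz1 fun h => ?_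
    have := hB z (by simpa using h)
    rw [mem_preimage, mem_singleton_iff] at hz2
    linarith
  have hZo : IsOpen Z := by
    rw [isOpen_iff_mem_nhds]
    intro z₀ hz₀
    have hzb := hZb hz₀
    obtain ⟨k, hkd, hke, hkl⟩ := hk z₀ hzb
    have hnb : ∀ᶠ z in 𝓝 z₀, z ∈ ball (0:ℂ) s := isOpen_ball.mem_nhds hzb
    have hz0 : E z₀ = E zm := hz₀.2
    have hloc : IsLocalMax (norm ∘ k) z₀ := by
      filter_upwards [hkl, hnb] with z h1 h2
      have : E z ≤ E zm := hmax (ball_subset_closedBall h2)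
      simp only [Function.comp]
      linarith
    have := Complex.norm_eventually_eq_of_isLocalMax hkd hloc
    filter_upwards [this, hkl, hnb] with z h1 h2 h3
    refine ⟨ball_subset_closedBall h3, ?_⟩
    have h4 : E z ≤ E zm := hmax (ball_subset_closedBall h3)
    rw [mem_preimage, mem_singleton_iff]
    linarith
  have hu : Z = univ := IsClopen.eq_univ ⟨hZc, hZo⟩ ⟨zm, hzm, rfl⟩
  have : (s:ℂ) ∈ Z := by rw [hu]; trivial
  have := hZb this
  simp [abs_of_pos hs] at this

lemma core (ε C : ℝ) (hε : 0 < ε) : ∃ M > (0:ℝ), ∀ (A B : ℂ → ℂ) (u : ℂ → ℝ) (a b : ℝ),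
    DifferentiableOn ℂ A (ball 0 1) → DifferentiableOn ℂ B (ball 0 1) →
    A 0 = a → B 0 = b → ContinuousOn u (ball 0 1) → (∀ z ∈ ball (0:ℂ) 1, u z ≤ C) →
    (∀ z₀ ∈ ball (0:ℂ) 1, ∃ σ τ : ℝ, 0 ≤ σ ∧ 0 ≤ τ ∧
      u z₀ = σ * (A z₀).re ^ 2 + τ * (B z₀).re ^ 2 ∧
      ∀ᶠ z in 𝓝 z₀, σ * (A z).re ^ 2 + τ * (B z).re ^ 2 ≤ u z) →
    (∀ z ∈ ball (0:ℂ) 1, ‖A z - a‖ < ε → ‖B z - b‖ < ε → u z = (A z).re ^ 2 + (B z).re ^ 2) →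
    ‖deriv A 0‖ ≤ M ∧ ‖deriv B 0‖ ≤ M := by
  set n : ℝ := ε / 3 with hn
  have hn0 : 0 < n := by positivity
  set δ : ℝ := n ^ 2 / 2 with hδ
  have hδ0 : 0 < δ := by positivity
  refine ⟨4 * n * Real.exp (C / δ), by positivity, ?_⟩
  intro A B u a b hA hB hA0 hB0 hu hC htouch hnear
  have hopen : IsOpen (ball (0:ℂ) 1) := isOpen_ball
  have hb0 : ball (0:ℂ) 1 ∈ 𝓝 (0:ℂ) := ball_mem_nhds _ one_pos
  set G : ℂ → ℂ × ℂ := fun z => (dslope A 0 z, dslope B 0 z) with hG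
  have hGd : DifferentiableOn ℂ G (ball 0 1) :=
    ((Complex.differentiableOn_dslope hb0).2 hA).prodMk
      ((Complex.differentiableOn_dslope hb0).2 hB)
  set P : ℂ → ℂ := fun z => (a:ℂ) ^ 2 + 2 * a * (A z - a) + (A z - a) ^ 2 / 2 +
    ((b:ℂ) ^ 2 + 2 * b * (B z - b) + (B z - b) ^ 2 / 2) with hP
  have hPd : DifferentiableOn ℂ P (ball 0 1) := by
    rw [hP]; fun_prop
  set c : ℝ := Real.exp 3 / n with hc
  have hc0 : 0 < c := by positivity
  set kin : ℂ → ℂ × ℂ := fun z => ((c:ℂ) * exp (P z / δ)) • G z with hkin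
  have hkd : DifferentiableOn ℂ kin (ball 0 1) := by
    rw [hkin]; exact ((hPd.div_const _).cexp.const_mul _).smul hGd
  set Eo : ℂ → ℝ := fun z => Real.exp (u z / δ) / ‖z‖ with hEo
  set N : ℂ → ℝ := fun z => ‖(A z - a, B z - b)‖ with hN
  have hNc : ContinuousOn N (ball 0 1) := by
    rw [hN]
    exact ((hA.continuousOn.sub continuousOn_const).prodMk
      (hB.continuousOn.sub continuousOn_const)).norm
  have hNG : ∀ z, N z = ‖z‖ * ‖G z‖ := by
    intro z
    rw [hN, hG, ← norm_smul]
    simp only [Prod.smul_mk]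
    have h1 := sub_smul_dslope A 0 z
    have h2 := sub_smul_dslope B 0 z
    rw [sub_zero] at h1 h2
    rw [h1, h2, hA0, hB0]
  have hkn : ∀ z, ‖kin z‖ = c * Real.exp ((P z).re / δ) * ‖G z‖ := by
    intro z
    rw [hkin]
    simp only [norm_smul, norm_mul, Complex.norm_exp, Complex.norm_real, Real.norm_eq_abs,
      abs_of_pos hc0, Complex.div_ofReal_re]
  set T : ℂ → ℝ := fun z => ‖A z - a‖ ^ 2 + ‖B z - b‖ ^ 2 with hT
  have hT1 : ∀ z, N z ^ 2 ≤ T z := by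
    intro z
    simp only [hN, hT, Prod.norm_def]
    rcases max_cases ‖A z - a‖ ‖B z - b‖ with ⟨h, _⟩ | ⟨h, _⟩ <;> rw [h] <;>
      nlinarith [sq_nonneg ‖A z - a‖, sq_nonneg ‖B z - b‖]
  have hNA : ∀ z, ‖A z - a‖ ≤ N z := fun z => le_max_left _ _
  have hNB : ∀ z, ‖B z - b‖ ≤ N z := fun z => le_max_right _ _
  have hT2 : ∀ z, T z ≤ 2 * N z ^ 2 := by
    intro z
    have h1 := pow_le_pow_left₀ (norm_nonneg _) (hNA z) 2
    have h2 := pow_le_pow_left₀ (norm_nonneg _) (hNB z) 2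
    simp only [hT]; linarith
  have hPu : ∀ z ∈ ball (0:ℂ) 1, N z < ε → u z = (P z).re + T z / 2 := by
    intro z hz hz2
    rw [hnear z hz ((hNA z).trans_lt hz2) ((hNB z).trans_lt hz2)]
    have h2 : ∀ w : ℂ, (w ^ 2 / 2).re = (w.re ^ 2 - w.im ^ 2) / 2 := by
      intro w
      have : w ^ 2 / 2 = w ^ 2 / ((2:ℝ):ℂ) := by norm_num
      rw [this, Complex.div_ofReal_re, pow_two, Complex.mul_re]; ring
    have h3 : ∀ (x : ℝ) (w : ℂ), (2 * (x:ℂ) * w).re = 2 * x * w.re := by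
      intro x w
      have : 2 * (x:ℂ) * w = ((2 * x : ℝ):ℂ) * w := by push_cast; ring
      rw [this, Complex.re_ofReal_mul]
    have h4 : ∀ (x : ℝ), ((x:ℂ)^2).re = x ^ 2 := by
      intro x
      rw [← Complex.ofReal_pow, Complex.ofReal_re]
    simp only [hP, hT, Complex.add_re, h2, h3, h4, Complex.sq_norm, Complex.normSq_apply,
      Complex.sub_re, Complex.sub_im, Complex.ofReal_re, Complex.ofReal_im]
    ring
  have hEi : ∀ z, z ≠ 0 → ‖kin z‖ = (c * N z) * Real.exp ((P z).re / δ) / ‖z‖ := by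
    intro z hz
    have : ‖z‖ ≠ 0 := norm_ne_zero_iff.2 hz
    rw [hkn, hNG]; field_simp
  have hEo' : ∀ z ∈ ball (0:ℂ) 1, N z < ε →
      Eo z = Real.exp (T z / 2 / δ) * Real.exp ((P z).re / δ) / ‖z‖ := by
    intro z hz hz2
    simp only [hEo]
    rw [hPu z hz hz2, ← Real.exp_add]; congr 2; ring
  have hN00 : N 0 = 0 := by simp [hNG]
  have hne : ∀ z, 0 < N z → z ≠ 0 := by
    rintro z hz rfl; rw [hN00] at hz; exact lt_irrefl _ hz
  have e1 : (2:ℝ) ≤ Real.exp 1 := by have := Real.add_one_le_exp (1:ℝ); linarith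
  have hcmp1 : ∀ z ∈ ball (0:ℂ) 1, N z = n → Eo z < ‖kin z‖ := by
    intro z hz hz2
    have hz0 : z ≠ 0 := hne z (by rw [hz2]; exact hn0)
    have hzn : 0 < ‖z‖ := norm_pos_iff.2 hz0
    rw [hEo' z hz (by rw [hz2, hn]; linarith), hEi z hz0, hz2]
    have h1 : c * n = Real.exp 3 := by rw [hc]; field_simp
    have h2 : T z / 2 / δ ≤ 2 := by
      rw [div_le_iff₀ hδ0]; have := hT2 z; rw [hz2] at this; rw [hδ]; linarith
    rw [h1]
    gcongr
    linarith
  have hcmp2 : ∀ z ∈ ball (0:ℂ) 1, N z = 2 * n → ‖kin z‖ < Eo z := by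
    intro z hz hz2
    have hz0 : z ≠ 0 := hne z (by rw [hz2]; linarith)
    have hzn : 0 < ‖z‖ := norm_pos_iff.2 hz0
    rw [hEo' z hz (by rw [hz2, hn]; linarith), hEi z hz0, hz2]
    have h1 : c * (2 * n) = 2 * Real.exp 3 := by rw [hc]; field_simp
    have h2 : 4 ≤ T z / 2 / δ := by
      rw [le_div_iff₀ hδ0]; have := hT1 z; rw [hz2] at this; rw [hδ]; linarith
    have e2 : (2:ℝ) < Real.exp 1 := by
      have := Real.add_one_lt_exp (one_ne_zero : (1:ℝ) ≠ 0); linarith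
    have h3 : 2 * Real.exp 3 < Real.exp (T z / 2 / δ) := by
      calc 2 * Real.exp 3 < Real.exp 1 * Real.exp 3 := by gcongr
        _ = Real.exp 4 := by rw [← Real.exp_add]; norm_num
        _ ≤ _ := Real.exp_le_exp.2 h2
    rw [h1]
    gcongr
  have hkc : ContinuousOn (fun z => ‖kin z‖) (ball 0 1) := hkd.continuousOn.norm
  have hEoc : ∀ z ∈ ball (0:ℂ) 1, z ≠ 0 → ContinuousAt Eo z := by
    intro z hz hz0
    have h1 : ContinuousAt u z := hu.continuousAt (hopen.mem_nhds hz)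
    exact ((h1.div_const δ).rexp).div continuous_norm.continuousAt (norm_ne_zero_iff.2 hz0)
  set E : ℂ → ℝ := fun z => if N z < n then ‖kin z‖ else
    if N z < 2 * n then max ‖kin z‖ (Eo z) else Eo z with hE
  have htri : ∀ z ∈ ball (0:ℂ) 1, (E =ᶠ[𝓝 z] fun z => ‖kin z‖) ∨
      (z ≠ 0 ∧ E =ᶠ[𝓝 z] fun z => max ‖kin z‖ (Eo z)) ∨ (z ≠ 0 ∧ E =ᶠ[𝓝 z] Eo) := by
    intro z hz
    have hNz : ContinuousAt N z := hNc.continuousAt (hopen.mem_nhds hz)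
    have hkz : ContinuousAt (fun z => ‖kin z‖) z := hkc.continuousAt (hopen.mem_nhds hz)
    rcases lt_trichotomy (N z) n with h | h | h
    · left
      filter_upwards [hNz.eventually_lt_const h] with w hw
      simp only [hE, if_pos hw]
    · left
      have hz0 := hne z (by rw [h]; exact hn0)
      filter_upwards [(hEoc z hz hz0).eventually_lt hkz (hcmp1 z hz h),
        hNz.eventually_lt_const (show N z < 2 * n by linarith)] with w h1 h2
      simp only [hE, if_pos h2, max_eq_left h1.le, ite_self]
    · right
      have hz0 := hne z (by linarith)
      rcases lt_trichotomy (N z) (2 * n) with h' | h' | h'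
      · left
        refine ⟨hz0, ?_⟩
        filter_upwards [hNz.eventually_lt_const h', hNz.eventually_const_lt h] with w h1 h2
        simp only [hE, if_pos h1, if_neg h2.not_gt]
      · right
        refine ⟨hz0, ?_⟩
        filter_upwards [hkz.eventually_lt (hEoc z hz hz0) (hcmp2 z hz h'),
          hNz.eventually_const_lt h] with w h1 h2
        simp only [hE, if_neg h2.not_gt, max_eq_right h1.le, ite_self]
      · right
        refine ⟨hz0, ?_⟩
        filter_upwards [hNz.eventually_const_lt h'] with w h1
        simp only [hE, if_neg h1.not_gt, if_neg (show ¬ N w < n by linarith)]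
  have hEc : ContinuousOn E (ball 0 1) := by
    intro z hz
    refine ContinuousAt.continuousWithinAt ?_
    have hkz : ContinuousAt (fun z => ‖kin z‖) z := hkc.continuousAt (hopen.mem_nhds hz)
    rcases htri z hz with h | ⟨h0, h⟩ | ⟨h0, h⟩
    · exact hkz.congr h.symm
    · have hm : ContinuousAt (fun z => max ‖kin z‖ (Eo z)) z := hkz.max (hEoc z hz h0)
      exact ContinuousAt.congr hm h.symm
    · exact (hEoc z hz h0).congr h.symm
  have hkinev : ∀ z ∈ ball (0:ℂ) 1, ∀ᶠ w in 𝓝 z, DifferentiableAt ℂ kin w := by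
    intro z hz
    filter_upwards [hopen.mem_nhds hz] with w hw
    exact hkd.differentiableAt (hopen.mem_nhds hw)
  have hout : ∀ z ∈ ball (0:ℂ) 1, z ≠ 0 → ∃ k : ℂ → ℂ × ℂ,
      (∀ᶠ w in 𝓝 z, DifferentiableAt ℂ k w) ∧ ‖k z‖ = Eo z ∧ ∀ᶠ w in 𝓝 z, ‖k w‖ ≤ Eo w := by
    intro z hz hz0
    obtain ⟨σ, τ, hσ, hτ, heq, hle⟩ := htouch z hz
    set Q : ℂ → ℂ := fun w => σ * (A w - (A z).im * I) ^ 2 + τ * (B w - (B z).im * I) ^ 2 with hQ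
    have hQre : ∀ w, (Q w).re = σ * ((A w).re ^ 2 - ((A w).im - (A z).im) ^ 2) +
        τ * ((B w).re ^ 2 - ((B w).im - (B z).im) ^ 2) := by
      intro w
      simp [hQ, pow_two]
    have hkn2 : ∀ w, ‖((exp (Q w / δ) / w, 0) : ℂ × ℂ)‖ = Real.exp ((Q w).re / δ) / ‖w‖ := by
      intro w
      rw [Prod.norm_mk, norm_zero, max_eq_left (norm_nonneg _), norm_div, Complex.norm_exp,
        Complex.div_ofReal_re]
    refine ⟨fun w => (exp (Q w / δ) / w, 0), ?_, ?_, ?_⟩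
    · filter_upwards [hopen.mem_nhds hz, isOpen_ne.mem_nhds hz0] with w hw hw0
      have hAw := hA.differentiableAt (hopen.mem_nhds hw)
      have hBw := hB.differentiableAt (hopen.mem_nhds hw)
      have hQw : DifferentiableAt ℂ Q w := by rw [hQ]; fun_prop
      exact (((hQw.div_const _).cexp).div differentiableAt_id hw0).prodMk
        (differentiableAt_const _)
    · rw [hkn2, hQre]; simp only [hEo, heq]; simp
    · filter_upwards [hle] with w hw
      rw [hkn2]
      simp only [hEo]
      gcongr
      rw [hQre]
      nlinarith [mul_nonneg hσ (sq_nonneg ((A w).im - (A z).im)),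
        mul_nonneg hτ (sq_nonneg ((B w).im - (B z).im))]
  have key := maxprin E (1/2) (by norm_num)
    (hEc.mono (closedBall_subset_ball (by norm_num))) ?_ (4 * Real.exp 3 * Real.exp (C / δ)) ?_
  · have h1 : E 0 = ‖kin 0‖ := by simp only [hE, hN00, if_pos hn0]
    rw [h1, hkn] at key
    have hP0 : 0 ≤ (P 0).re := by
      have : P 0 = ((a ^ 2 + b ^ 2 : ℝ) : ℂ) := by
        simp [hP, hA0, hB0]
      rw [this, Complex.ofReal_re]; positivity
    have h2 : (1:ℝ) ≤ Real.exp ((P 0).re / δ) := Real.one_le_exp (by positivity)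
    have h3 : c * ‖G 0‖ ≤ 4 * Real.exp 3 * Real.exp (C / δ) := by
      refine le_trans ?_ key
      rw [mul_right_comm]
      exact le_mul_of_one_le_right (by positivity) h2
    have h4 : ‖G 0‖ ≤ 4 * n * Real.exp (C / δ) := by
      rw [hc, div_mul_eq_mul_div, div_le_iff₀ hn0] at h3
      have h5 : 0 < Real.exp 3 := Real.exp_pos _
      refine le_of_mul_le_mul_left ?_ h5
      linarith
    simp only [hG, dslope_same] at h4
    exact ⟨(le_max_left _ _).trans h4, (le_max_right _ _).trans h4⟩
  · intro z hz
    have hz1 : z ∈ ball (0:ℂ) 1 := ball_subset_ball (by norm_num) hz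
    rcases htri z hz1 with h | ⟨h0, h⟩ | ⟨h0, h⟩
    · exact ⟨kin, hkinev z hz1, h.eq_of_nhds.symm, h.mono fun w hw => hw.ge⟩
    · rcases le_total ‖kin z‖ (Eo z) with h' | h'
      · obtain ⟨k, k1, k2, k3⟩ := hout z hz1 h0
        refine ⟨k, k1, ?_, ?_⟩
        · rw [h.eq_of_nhds, max_eq_right h', k2]
        · filter_upwards [h, k3] with w h1 h2
          rw [h1]; exact h2.trans (le_max_right _ _)
      · refine ⟨kin, hkinev z hz1, ?_, ?_⟩
        · rw [h.eq_of_nhds, max_eq_left h']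
        · filter_upwards [h] with w h1
          rw [h1]; exact le_max_left _ _
    · obtain ⟨k, k1, k2, k3⟩ := hout z hz1 h0
      refine ⟨k, k1, ?_, ?_⟩
      · rw [h.eq_of_nhds, k2]
      · filter_upwards [h, k3] with w h1 h2
        rw [h1]; exact h2
  · intro z hz
    rw [mem_sphere_zero_iff_norm] at hz
    have hz1 : z ∈ ball (0:ℂ) 1 := by rw [mem_ball_zero_iff, hz]; norm_num
    have hz0 : z ≠ 0 := by rw [← norm_pos_iff, hz]; norm_num
    have hX : 0 < Real.exp (C / δ) := Real.exp_pos _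
    have hbo : Eo z ≤ 4 * Real.exp 3 * Real.exp (C / δ) := by
      have h1 : Real.exp (u z / δ) ≤ Real.exp (C / δ) := by
        gcongr; exact hC z hz1
      have h2 : (1:ℝ) ≤ Real.exp 3 := Real.one_le_exp (by norm_num)
      simp only [hEo, hz]
      nlinarith
    have hbi : N z < 2 * n → ‖kin z‖ ≤ 4 * Real.exp 3 * Real.exp (C / δ) := by
      intro h
      have hT0 : 0 ≤ T z := by simp only [hT]; positivity
      have h0 := hPu z hz1 (by linarith)
      have h1 : Real.exp ((P z).re / δ) ≤ Real.exp (C / δ) := by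
        gcongr; linarith [hC z hz1]
      rw [hEi z hz0, hz]
      have h2 : c * N z ≤ 2 * Real.exp 3 := by
        calc c * N z ≤ c * (2 * n) := by gcongr
          _ = _ := by rw [hc]; field_simp
      have h3 : c * N z * Real.exp ((P z).re / δ) ≤ 2 * Real.exp 3 * Real.exp (C / δ) := by
        gcongr
      linarith
    simp only [hE]
    split_ifs with h1 h2
    · exact hbi (by linarith)
    · exact max_le (hbi h2) hbo
    · exact hbo

/-- A harmonic function is the real part of a holomorphic function. -/
lemma holo_of_harmonic (u : ℂ → ℝ) (hu : HarmonicOn u (ball 0 1)) :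
    ∃ F : ℂ → ℂ, DifferentiableOn ℂ F (ball 0 1) ∧ F 0 = (u 0 : ℝ) ∧
      ∀ z ∈ ball (0:ℂ) 1, (F z).re = u z := by
  obtain ⟨h1, h2⟩ := hu
  have hopen : IsOpen (ball (0:ℂ) 1) := isOpen_ball
  have hlap : ∀ z ∈ ball (0:ℂ) 1, Laplacian.laplacian u z = 0 := by
    intro z hz
    rw [InnerProductSpace.laplacian_eq_iteratedFDeriv_complexPlane]
    simp only [iteratedFDeriv_two_apply]
    rw [← h2 z hz]
    have hd : DifferentiableAt ℝ (fderiv ℝ u) z :=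
      ((h1.contDiffAt (hopen.mem_nhds hz)).fderiv_right (m := 1) (by norm_num)).differentiableAt
        (by norm_num)
    unfold laplacian
    rw [fderiv_clm_apply hd (differentiableAt_const _), fderiv_clm_apply hd (differentiableAt_const _)]
    simp
  have hharm : InnerProductSpace.HarmonicOnNhd u (ball 0 1) := by
    intro z hz
    refine ⟨h1.contDiffAt (hopen.mem_nhds hz), ?_⟩
    filter_upwards [hopen.mem_nhds hz] with w hw
    exact hlap w hw
  obtain ⟨F, hF, hFe⟩ := hharm.exists_analyticOnNhd_ball_re_eq
  refine ⟨fun z => F z - (F 0).im * I, hF.differentiableOn.sub_const _, ?_, ?_⟩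
  · rw [← hFe (mem_ball_self one_pos)]
    apply Complex.ext <;> simp
  · intro z hz
    rw [← hFe hz]; simp

lemma geom (g₁ g₂ : ℝ → ℝ)
    (hpos₁ : ∀ φ, 0 < g₁ φ)
    (hcont₁ : Continuous g₁) (hcont₂ : Continuous g₂)
    (hmono₁ : StrictMono g₁) (hle : ∀ φ, g₂ φ ≤ g₁ (φ + 2 * Real.pi))
    (D : Set (ℝ × ℝ))
    (hD : D = {x | ∃ r φ : ℝ, g₁ φ < r ∧ r < g₂ φ ∧ x = (r * Real.cos φ, r * Real.sin φ)}) :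
    ∃ Φ : ℝ × ℝ → ℝ, IsOpen D ∧ ContinuousOn Φ D ∧ ∀ y ∈ D, ∃ r, 0 < r ∧ r < g₂ (Φ y) ∧
      y = (r * Real.cos (Φ y), r * Real.sin (Φ y)) := by
  have huniq : ∀ r φ r' φ' : ℝ, g₁ φ < r → r < g₂ φ → g₁ φ' < r' → r' < g₂ φ' →
      r * Real.cos φ = r' * Real.cos φ' → r * Real.sin φ = r' * Real.sin φ' → φ = φ' := by
    intro r φ r' φ' h1 h2 h3 h4 hc hs
    have hr : 0 < r := (hpos₁ φ).trans h1
    have hr' : 0 < r' := (hpos₁ φ').trans h3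
    have hrr : r = r' := by
      have : r ^ 2 = r' ^ 2 := by
        calc r ^ 2 = (r * Real.cos φ) ^ 2 + (r * Real.sin φ) ^ 2 := by
              have := Real.sin_sq_add_cos_sq φ
              linear_combination (-r^2) * this
          _ = (r' * Real.cos φ') ^ 2 + (r' * Real.sin φ') ^ 2 := by rw [hc, hs]
          _ = r' ^ 2 := by
              have := Real.sin_sq_add_cos_sq φ'
              linear_combination (r'^2) * this
      exact (pow_left_inj₀ hr.le hr'.le two_ne_zero).1 this
    subst hrr
    have hc' := mul_left_cancel₀ hr.ne' hc
    have hs' := mul_left_cancel₀ hr.ne' hs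
    obtain ⟨k, hk⟩ := Real.Angle.angle_eq_iff_two_pi_dvd_sub.1 (Real.Angle.cos_sin_inj hc' hs')
    have hpi := Real.pi_pos
    rcases lt_trichotomy k 0 with h | h | h
    · exfalso
      have hk1 : (k:ℝ) ≤ -1 := by exact_mod_cast (show k ≤ -1 by omega)
      have : φ + 2 * Real.pi ≤ φ' := by nlinarith
      have := hmono₁.monotone this
      linarith [hle φ]
    · subst h; simp at hk; linarith
    · exfalso
      have hk1 : (1:ℝ) ≤ k := by exact_mod_cast (show 1 ≤ k by omega)
      have : φ' + 2 * Real.pi ≤ φ := by nlinarith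
      have := hmono₁.monotone this
      linarith [hle φ']
  have hex : ∀ y : ℝ × ℝ, ∃ φ : ℝ, y ∈ D → ∃ r, g₁ φ < r ∧ r < g₂ φ ∧
      y = (r * Real.cos φ, r * Real.sin φ) := by
    intro y
    by_cases hy : y ∈ D
    · have hy' := hy
      rw [hD] at hy'
      obtain ⟨r, φ, h⟩ := hy'
      exact ⟨φ, fun _ => ⟨r, h⟩⟩
    · exact ⟨0, fun h => absurd h hy⟩
  choose Φ hΦ using hex
  have hloc : ∀ y₀ ∈ D, ∃ ψ : ℝ × ℝ → ℝ, ContinuousAt ψ y₀ ∧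
      ∀ᶠ y in 𝓝 y₀, y ∈ D ∧ Φ y = ψ y := by
    intro y₀ hy₀
    obtain ⟨r₀, h1, h2, h3⟩ := hΦ y₀ hy₀
    set φ₀ := Φ y₀
    have hr₀ : 0 < r₀ := (hpos₁ _).trans h1
    set w : ℝ × ℝ → ℂ := fun y => ((y.1:ℂ) + y.2 * I) * exp (-(φ₀ * I)) with hw
    have hwc : Continuous w := by rw [hw]; fun_prop
    have hw0 : w y₀ = (r₀ : ℂ) := by
      have : ((y₀.1:ℂ) + y₀.2 * I) = r₀ * exp (φ₀ * I) := by
        rw [h3, Complex.exp_mul_I]; push_cast; ring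
      simp only [hw]
      rw [this, mul_assoc, ← Complex.exp_add]; simp
    have hslit : w y₀ ∈ slitPlane := by rw [hw0]; exact Complex.ofReal_mem_slitPlane.2 hr₀
    set ψ : ℝ × ℝ → ℝ := fun y => φ₀ + arg (w y) with hψ
    have hψc : ContinuousAt ψ y₀ := by
      have : ContinuousAt (fun y => arg (w y)) y₀ :=
        ContinuousAt.comp (f := w) (g := arg) (Complex.continuousAt_arg hslit) hwc.continuousAt
      exact continuousAt_const.add this
    have hψ0 : ψ y₀ = φ₀ := by
      simp only [hψ, hw0, Complex.arg_ofReal_of_nonneg hr₀.le, add_zero]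
    have hn0 : ‖w y₀‖ = r₀ := by rw [hw0, Complex.norm_real, Real.norm_eq_abs, abs_of_pos hr₀]
    have hpolar : ∀ y, y = (‖w y‖ * Real.cos (ψ y), ‖w y‖ * Real.sin (ψ y)) := by
      intro y
      have h5 : ((y.1:ℂ) + y.2 * I) = ‖w y‖ * exp (ψ y * I) := by
        have : (ψ y : ℂ) * I = arg (w y) * I + φ₀ * I := by simp only [hψ]; push_cast; ring
        rw [this, Complex.exp_add, ← mul_assoc, Complex.norm_mul_exp_arg_mul_I]
        simp only [hw]
        rw [mul_assoc, ← Complex.exp_add]; simp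
      rw [Complex.exp_mul_I, ← Complex.ofReal_cos, ← Complex.ofReal_sin] at h5
      have hre := congrArg Complex.re h5
      have him := congrArg Complex.im h5
      simp at hre him
      exact Prod.ext hre him
    refine ⟨ψ, hψc, ?_⟩
    have hnc : ContinuousAt (fun y => ‖w y‖) y₀ := hwc.norm.continuousAt
    have hg1 : ContinuousAt (fun y => g₁ (ψ y)) y₀ :=
      ContinuousAt.comp (f := ψ) (g := g₁) hcont₁.continuousAt hψc
    have hg2 : ContinuousAt (fun y => g₂ (ψ y)) y₀ :=
      ContinuousAt.comp (f := ψ) (g := g₂) hcont₂.continuousAt hψc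
    filter_upwards [hg1.eventually_lt hnc (by rw [hψ0, hn0]; exact h1),
      hnc.eventually_lt hg2 (by rw [hψ0, hn0]; exact h2)] with y e1 e2
    have hyD : y ∈ D := by rw [hD]; exact ⟨_, _, e1, e2, hpolar y⟩
    refine ⟨hyD, ?_⟩
    obtain ⟨r, k1, k2, k3⟩ := hΦ y hyD
    have h6 := k3.symm.trans (hpolar y)
    exact huniq _ _ _ _ k1 k2 e1 e2 (congrArg Prod.fst h6) (congrArg Prod.snd h6)
  refine ⟨Φ, ?_, ?_, ?_⟩
  · rw [isOpen_iff_mem_nhds]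
    intro y hy
    obtain ⟨ψ, -, h⟩ := hloc y hy
    exact h.mono fun _ h => h.1
  · intro y hy
    obtain ⟨ψ, hc, h⟩ := hloc y hy
    refine ContinuousAt.continuousWithinAt (ContinuousAt.congr hc ?_)
    exact h.mono fun _ h => h.2.symm
  · intro y hy
    obtain ⟨r, k1, k2, k3⟩ := hΦ y hy
    exact ⟨r, (hpos₁ _).trans k1, k2, k3⟩

/-- The basic bounded locally convex function: a linear function on a half turn, zero elsewhere. -/
lemma rho_exists (g₂ : ℝ → ℝ) (hmono₂ : StrictMono g₂) (D : Set (ℝ × ℝ)) (Φ : ℝ × ℝ → ℝ)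
    (hO : IsOpen D) (hΦ : ContinuousOn Φ D)
    (hp : ∀ y ∈ D, ∃ r, 0 < r ∧ r < g₂ (Φ y) ∧ y = (r * Real.cos (Φ y), r * Real.sin (Φ y)))
    (α : ℝ) :
    ∃ ρ : ℝ × ℝ → ℝ, ContinuousOn ρ D ∧ (∀ y ∈ D, ρ y ^ 2 ≤ g₂ (α + Real.pi) ^ 2) ∧
      (∀ y ∈ D, 0 ≤ Φ y - α → Φ y - α ≤ Real.pi → ρ y = Real.cos α * y.2 - Real.sin α * y.1) ∧
      ∀ y ∈ D, ∃ σ : ℝ, 0 ≤ σ ∧ ρ y ^ 2 = σ * (Real.cos α * y.2 - Real.sin α * y.1) ^ 2 ∧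
        ∀ᶠ w in 𝓝 y, σ * (Real.cos α * w.2 - Real.sin α * w.1) ^ 2 ≤ ρ w ^ 2 := by
  have hpi := Real.pi_pos
  set ρ : ℝ × ℝ → ℝ := fun y => Real.sqrt (y.1 ^ 2 + y.2 ^ 2) *
    Real.sin (max 0 (min (Φ y - α) Real.pi)) with hρ
  have hsq : ∀ y ∈ D, ∃ r, 0 < r ∧ r < g₂ (Φ y) ∧ Real.sqrt (y.1 ^ 2 + y.2 ^ 2) = r ∧
      Real.cos α * y.2 - Real.sin α * y.1 = r * Real.sin (Φ y - α) := by
    intro y hy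
    obtain ⟨r, h1, h2, h3⟩ := hp y hy
    have e1 : y.1 = r * Real.cos (Φ y) := congrArg Prod.fst h3
    have e2 : y.2 = r * Real.sin (Φ y) := congrArg Prod.snd h3
    refine ⟨r, h1, h2, ?_, ?_⟩
    · have : y.1 ^ 2 + y.2 ^ 2 = r ^ 2 := by
        rw [e1, e2]
        linear_combination (r^2) * Real.sin_sq_add_cos_sq (Φ y)
      rw [this, Real.sqrt_sq h1.le]
    · rw [Real.sin_sub, e1, e2]; ring
  have hin : ∀ y ∈ D, 0 ≤ Φ y - α → Φ y - α ≤ Real.pi →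
      ρ y = Real.cos α * y.2 - Real.sin α * y.1 := by
    intro y hy h1 h2
    obtain ⟨r, -, -, hr, hl⟩ := hsq y hy
    simp only [hρ]
    rw [hr, hl, min_eq_left h2, max_eq_right h1]
  refine ⟨ρ, ?_, ?_, hin, ?_⟩
  · rw [hρ]
    refine ContinuousOn.mul (by fun_prop) ?_
    exact Real.continuous_sin.comp_continuousOn
      ((continuous_const.max (continuous_id.min continuous_const)).comp_continuousOn
        (hΦ.sub continuousOn_const))
  · intro y hy
    obtain ⟨r, hr0, hr2, hr, hl⟩ := hsq y hy
    simp only [hρ, hr]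
    rcases le_total (Φ y - α) Real.pi with h | h
    · have h1 : r ≤ g₂ (α + Real.pi) :=
        hr2.le.trans (hmono₂.monotone (by linarith))
      have h2 := Real.sin_sq_le_one (max 0 (min (Φ y - α) Real.pi))
      rw [mul_pow]
      have h3 : r ^ 2 ≤ g₂ (α + Real.pi) ^ 2 := pow_le_pow_left₀ hr0.le h1 2
      nlinarith [sq_nonneg r]
    · rw [min_eq_right h, max_eq_right hpi.le, Real.sin_pi]
      simp only [mul_zero]; nlinarith [sq_nonneg (g₂ (α + Real.pi))]
  · intro y hy
    have hΦy : ContinuousAt (fun w => Φ w - α) y :=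
      (hΦ.continuousAt (hO.mem_nhds hy)).sub continuousAt_const
    by_cases h : 0 < Φ y - α ∧ Φ y - α < Real.pi
    · refine ⟨1, zero_le_one, ?_, ?_⟩
      · rw [hin y hy h.1.le h.2.le, one_mul]
      · filter_upwards [hΦy.eventually_const_lt h.1, hΦy.eventually_lt_const h.2,
          hO.mem_nhds hy] with w h1 h2 h3
        rw [hin w h3 h1.le h2.le, one_mul]
    · refine ⟨0, le_rfl, ?_, ?_⟩
      · have : Real.sin (max 0 (min (Φ y - α) Real.pi)) = 0 := by
          by_cases h1 : 0 < Φ y - α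
          · have h2 : Real.pi ≤ Φ y - α := by
              by_contra h3; exact h ⟨h1, not_le.1 h3⟩
            rw [min_eq_right h2, max_eq_right hpi.le, Real.sin_pi]
          · rw [max_eq_left ((min_le_left _ _).trans (not_lt.1 h1)), Real.sin_zero]
        simp only [hρ, this]; ring
      · filter_upwards with w
        rw [zero_mul]; positivity

/-- The domain between two spirals `r = g₁(φ)` and `r = g₂(φ)` (with `g₁ < g₂ ≤ g₁(· + 2π)`)
satisfies the harmonic-map derivative bound; i.e. the tube domain over it is
Kobayashi-hyperbolic. -/
theorem spiral_domain_hyperbolic (g₁ g₂ : ℝ → ℝ)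
    (hpos₁ : ∀ φ, 0 < g₁ φ) (hpos₂ : ∀ φ, 0 < g₂ φ)
    (hcont₁ : Continuous g₁) (hcont₂ : Continuous g₂)
    (hmono₁ : StrictMono g₁) (hmono₂ : StrictMono g₂)
    (hbot₁ : Tendsto g₁ atBot (𝓝 0)) (hbot₂ : Tendsto g₂ atBot (𝓝 0))
    (htop₁ : Tendsto g₁ atTop atTop) (htop₂ : Tendsto g₂ atTop atTop)
    (hlt : ∀ φ, g₁ φ < g₂ φ) (hle : ∀ φ, g₂ φ ≤ g₁ (φ + 2 * Real.pi))
    (D : Set (ℝ × ℝ))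
    (hD : D = {x | ∃ r φ : ℝ, g₁ φ < r ∧ r < g₂ φ ∧ x = (r * Real.cos φ, r * Real.sin φ)})
    (x : ℝ × ℝ) (hx : x ∈ D) :
    ∃ U ⊆ D, U ∈ 𝓝 x ∧ ∃ M > (0 : ℝ),
      ∀ f : ℂ → ℝ × ℝ, HarmonicMapOn f (ball (0 : ℂ) 1) →
        MapsTo f (ball (0 : ℂ) 1) D → f 0 ∈ U →
          ‖fderiv ℝ f 0‖ < M := by
  obtain ⟨Φ, hO, hΦ, hp⟩ := geom g₁ g₂ hpos₁ hcont₁ hcont₂ hmono₁ hle D hD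
  have hpi := Real.pi_pos
  set α : ℝ := Φ x - 3 * Real.pi / 4 with hα
  obtain ⟨ρ, ρc, ρb, ρi, ρt⟩ := rho_exists g₂ hmono₂ D Φ hO hΦ hp α
  obtain ⟨η, ηc, ηb, ηi, ηt⟩ := rho_exists g₂ hmono₂ D Φ hO hΦ hp (α + Real.pi / 2)
  rw [Real.cos_add_pi_div_two, Real.sin_add_pi_div_two] at ηi ηt
  have hΦx : ContinuousAt Φ x := hΦ.continuousAt (hO.mem_nhds hx)
  have hev : ∀ᶠ y in 𝓝 x, y ∈ D ∧ α + Real.pi / 2 < Φ y ∧ Φ y < α + Real.pi := by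
    filter_upwards [hO.mem_nhds hx,
      hΦx.eventually_const_lt (show α + Real.pi / 2 < Φ x by rw [hα]; linarith),
      hΦx.eventually_lt_const (show Φ x < α + Real.pi by rw [hα]; linarith)] with y h1 h2 h3
    exact ⟨h1, h2, h3⟩
  obtain ⟨e, he, hball⟩ := Metric.eventually_nhds_iff_ball.1 hev
  obtain ⟨M, hM, hcore⟩ := core (e / 4)
    (g₂ (α + Real.pi) ^ 2 + g₂ (α + Real.pi / 2 + Real.pi) ^ 2) (by positivity)
  refine ⟨ball x (e / 2), fun y hy => (hball y (ball_subset_ball (by linarith) hy)).1,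
    ball_mem_nhds _ (by positivity), 2 * M + 1, by positivity, ?_⟩
  intro f hf hmap hf0
  obtain ⟨F₁, hF₁, hF₁0, hF₁r⟩ := holo_of_harmonic _ hf.1
  obtain ⟨F₂, hF₂, hF₂0, hF₂r⟩ := holo_of_harmonic _ hf.2
  have hopen : IsOpen (ball (0:ℂ) 1) := isOpen_ball
  have hfc : ContinuousOn f (ball 0 1) := hf.1.1.continuousOn.prodMk hf.2.1.continuousOn
  set cα := Real.cos α with hcα
  set sα := Real.sin α with hsα
  have hcs : cα ^ 2 + sα ^ 2 = 1 := Real.cos_sq_add_sin_sq α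
  set A : ℂ → ℂ := fun z => cα * F₂ z - sα * F₁ z with hA
  set B : ℂ → ℂ := fun z => -sα * F₂ z - cα * F₁ z with hB
  have hAd : DifferentiableOn ℂ A (ball 0 1) := by rw [hA]; fun_prop
  have hBd : DifferentiableOn ℂ B (ball 0 1) := by rw [hB]; fun_prop
  have hAr : ∀ z ∈ ball (0:ℂ) 1, (A z).re = cα * (f z).2 - sα * (f z).1 := by
    intro z hz
    rw [← hF₁r z hz, ← hF₂r z hz]; simp [hA]
  have hBr : ∀ z ∈ ball (0:ℂ) 1, (B z).re = -sα * (f z).2 - cα * (f z).1 := by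
    intro z hz
    rw [← hF₁r z hz, ← hF₂r z hz]; simp [hB]
  have hmain := hcore A B (fun z => ρ (f z) ^ 2 + η (f z) ^ 2)
    (cα * (f 0).2 - sα * (f 0).1) (-sα * (f 0).2 - cα * (f 0).1) hAd hBd
    (by simp only [hA, hF₁0, hF₂0]; push_cast; ring)
    (by simp only [hB, hF₁0, hF₂0]; push_cast; ring)
    (((ρc.comp hfc hmap).pow 2).add ((ηc.comp hfc hmap).pow 2))
    (fun z hz => add_le_add (ρb _ (hmap hz)) (ηb _ (hmap hz)))
    ?_ ?_
  · obtain ⟨hMA, hMB⟩ := hmain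
    have h0 : (0:ℂ) ∈ ball (0:ℂ) 1 := mem_ball_self one_pos
    have hn0 := hopen.mem_nhds h0
    have hd1 : HasDerivAt F₁ (deriv F₁ 0) 0 := (hF₁.differentiableAt hn0).hasDerivAt
    have hd2 : HasDerivAt F₂ (deriv F₂ 0) 0 := (hF₂.differentiableAt hn0).hasDerivAt
    have hAder : deriv A 0 = cα * deriv F₂ 0 - sα * deriv F₁ 0 :=
      ((hd2.const_mul _).sub (hd1.const_mul _)).deriv
    have hBder : deriv B 0 = -sα * deriv F₂ 0 - cα * deriv F₁ 0 :=
      ((hd2.const_mul _).sub (hd1.const_mul _)).deriv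
    have hcsC : (cα:ℂ) ^ 2 + (sα:ℂ) ^ 2 = 1 := by exact_mod_cast hcs
    have hc1 : |cα| ≤ 1 := Real.abs_cos_le_one α
    have hs1 : |sα| ≤ 1 := Real.abs_sin_le_one α
    have hmulle : ∀ (t : ℝ) (w : ℂ), |t| ≤ 1 → ‖w‖ ≤ M → ‖(t:ℂ) * w‖ ≤ M := by
      intro t w ht hw
      rw [norm_mul, Complex.norm_real, Real.norm_eq_abs]
      nlinarith [abs_nonneg t, norm_nonneg w]
    have h1 : ‖deriv F₁ 0‖ ≤ 2 * M := by
      have : deriv F₁ 0 = -((sα:ℂ) * deriv A 0 + cα * deriv B 0) := by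
        rw [hAder, hBder]; linear_combination (-deriv F₁ 0) * hcsC
      rw [this, norm_neg]
      refine (norm_add_le _ _).trans ?_
      linarith [hmulle sα _ hs1 hMA, hmulle cα _ hc1 hMB]
    have h2 : ‖deriv F₂ 0‖ ≤ 2 * M := by
      have : deriv F₂ 0 = (cα:ℂ) * deriv A 0 - sα * deriv B 0 := by
        rw [hAder, hBder]; linear_combination (-deriv F₂ 0) * hcsC
      rw [this]
      refine (norm_sub_le _ _).trans ?_
      linarith [hmulle cα _ hc1 hMA, hmulle sα _ hs1 hMB]
    have hfe : f =ᶠ[𝓝 0] fun z => ((F₁ z).re, (F₂ z).re) := by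
      filter_upwards [hn0] with z hz
      rw [hF₁r z hz, hF₂r z hz]
    have hr1 : HasFDerivAt (fun z => (F₁ z).re) (reCLM.comp
        ((ContinuousLinearMap.toSpanSingleton ℂ (deriv F₁ 0)).restrictScalars ℝ)) (0:ℂ) :=
      reCLM.hasFDerivAt.comp (0:ℂ) (hd1.hasFDerivAt.restrictScalars ℝ)
    have hr2 : HasFDerivAt (fun z => (F₂ z).re) (reCLM.comp
        ((ContinuousLinearMap.toSpanSingleton ℂ (deriv F₂ 0)).restrictScalars ℝ)) (0:ℂ) :=
      reCLM.hasFDerivAt.comp (0:ℂ) (hd2.hasFDerivAt.restrictScalars ℝ)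
    rw [hfe.fderiv_eq, (hr1.prodMk hr2).fderiv]
    refine lt_of_le_of_lt (ContinuousLinearMap.opNorm_le_bound _ (by positivity : 0 ≤ 2 * M) ?_)
      (by linarith)
    intro v
    have hb : ∀ d : ℂ, ‖d‖ ≤ 2 * M → ‖(v * d).re‖ ≤ 2 * M * ‖v‖ := by
      intro d hd
      refine (Complex.abs_re_le_norm _).trans ?_
      rw [norm_mul, mul_comm]
      gcongr
    exact max_le (hb _ h1) (hb _ h2)
  · intro z₀ hz₀
    obtain ⟨σ, hσ, s1, s2⟩ := ρt _ (hmap hz₀)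
    obtain ⟨τ, hτ, t1, t2⟩ := ηt _ (hmap hz₀)
    have hfz : ContinuousAt f z₀ := hfc.continuousAt (hopen.mem_nhds hz₀)
    refine ⟨σ, τ, hσ, hτ, ?_, ?_⟩
    · rw [hAr z₀ hz₀, hBr z₀ hz₀, s1, t1]
    · filter_upwards [hopen.mem_nhds hz₀, hfz.eventually s2, hfz.eventually t2] with z h1 h2 h3
      rw [hAr z h1, hBr z h1]
      exact add_le_add h2 h3
  · intro z hz h1 h2
    have h1' := (Complex.abs_re_le_norm _).trans_lt h1
    have h2' := (Complex.abs_re_le_norm _).trans_lt h2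
    rw [Complex.sub_re, Complex.ofReal_re, hAr z hz] at h1'
    rw [Complex.sub_re, Complex.ofReal_re, hBr z hz] at h2'
    set p := cα * (f z).2 - sα * (f z).1 - (cα * (f 0).2 - sα * (f 0).1) with hpdef
    set q := -sα * (f z).2 - cα * (f z).1 - (-sα * (f 0).2 - cα * (f 0).1) with hqdef
    have hc1 : |cα| ≤ 1 := Real.abs_cos_le_one α
    have hs1 : |sα| ≤ 1 := Real.abs_sin_le_one α
    have hmulle : ∀ t w : ℝ, |t| ≤ 1 → |w| < e / 4 → |t * w| < e / 4 := by
      intro t w ht hw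
      rw [abs_mul]
      nlinarith [abs_nonneg t, abs_nonneg w]
    have hx1 : |(f z).1 - (f 0).1| < e / 2 := by
      have : (f z).1 - (f 0).1 = -(sα * p + cα * q) := by
        rw [hpdef, hqdef]; linear_combination (-((f z).1 - (f 0).1)) * hcs
      rw [this, abs_neg]
      refine (abs_add_le _ _).trans_lt ?_
      linarith [hmulle sα p hs1 h1', hmulle cα q hc1 h2']
    have hx2 : |(f z).2 - (f 0).2| < e / 2 := by
      have : (f z).2 - (f 0).2 = cα * p - sα * q := by
        rw [hpdef, hqdef]; linear_combination (-((f z).2 - (f 0).2)) * hcs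
      rw [this]
      refine (abs_sub _ _).trans_lt ?_
      linarith [hmulle cα p hc1 h1', hmulle sα q hs1 h2']
    have hdist : dist (f z) (f 0) < e / 2 := by
      rw [Prod.dist_eq, Real.dist_eq, Real.dist_eq]
      exact max_lt hx1 hx2
    have hfz : f z ∈ ball x e := by
      rw [mem_ball] at hf0 ⊢
      linarith [dist_triangle (f z) (f 0) x]
    obtain ⟨k1, k2, k3⟩ := hball _ hfz
    rw [ρi _ k1 (by linarith) (by linarith), ηi _ k1 (by linarith) (by linarith), hAr z hz,
      hBr z hz]
end
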